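/- arXiv:1604.04720 — 10 statements merged into one kernel-verified Lean document; each statement's English description precedes it below -/
import Mathlib

section
/- Let u ≥ 0, v ≥ 0 and h ≥ 1 be real numbers. Then every real number x ≥ 1 satisfying x = u + v·(log x)^h satisfies x < max{2^h·(u^{1/h} + v^{1/h}·log(h^h·v))^h, 2^h·(u^{1/h} + 2e²)^h}. -/
/-- If `y ≤ a + c log y` with `c > 0`, then `y < 2 (a + c log c)`. -/
theorem lt_two_mul_of_le_add_mul_log {a c y : ℝ} (hc : 0 < c) (hy : 0 < y)
    (h : y ≤ a + c * Real.log y) : y < 2 * (a + c * Real.log c) := by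
  have hlog : Real.log y - (Real.log 2 + Real.log c) ≤ y / (2 * c) - 1 := by
    rw [← Real.log_mul two_ne_zero hc.ne', ← Real.log_div hy.ne' (by positivity)]
    exact Real.log_le_sub_one_of_pos (by positivity)
  have hmul := mul_le_mul_of_nonneg_left hlog hc.le
  have hdiv : c * (y / (2 * c) - 1) = y / 2 - c := by
    field_simp
  have hlog2 : c * Real.log 2 < c :=
    mul_lt_of_lt_one_right hc (by linarith [Real.log_two_lt_d9])
  linarith

/-- Lemma of Pethő–de Weger: if `x ≥ 1` satisfies
`x = u + v·(log x)^h` with `u, v ≥ 0` and `h ≥ 1`, then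
`x < max{2^h(u^{1/h} + v^{1/h} log(h^h v))^h, 2^h(u^{1/h} + 2e²)^h}`. -/
theorem stmt_1 (u v h : ℝ) (hu : 0 ≤ u) (hv : 0 ≤ v) (hh : 1 ≤ h)
    (x : ℝ) (hx : 1 ≤ x) (hxeq : x = u + v * (Real.log x) ^ h) :
    x < max (2 ^ h * (u ^ (1 / h) + v ^ (1 / h) * Real.log (h ^ h * v)) ^ h)
            (2 ^ h * (u ^ (1 / h) + 2 * Real.exp 2) ^ h) := by
  have h0 : 0 < h := by linarith
  have hx0 : 0 < x := by linarith
  have root_pow {z : ℝ} (hz : 0 ≤ z) : (z ^ (1 / h)) ^ h = z := by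
    rw [one_div, Real.rpow_inv_rpow hz h0.ne']
  have hy : 0 < x ^ (1 / h) := by positivity
  have hL : 0 ≤ Real.log x := Real.log_nonneg hx
  have ha : 0 ≤ u ^ (1 / h) := by positivity
  have of_root_lt {B : ℝ} (hB : x ^ (1 / h) < 2 * B) : x < 2 ^ h * B ^ h := by
    rw [← Real.mul_rpow zero_le_two (by linarith)]
    calc x = (x ^ (1 / h)) ^ h := (root_pow hx0.le).symm
      _ < (2 * B) ^ h := Real.rpow_lt_rpow hy.le hB h0
  rcases hv.eq_or_lt with rfl | hv0
  · refine lt_max_of_lt_right (of_root_lt ?_)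
    have hxu : x = u := by simpa using hxeq
    rw [hxu]
    linarith [Real.exp_pos 2]
  · refine lt_max_of_lt_left (of_root_lt ?_)
    have hb : 0 < v ^ (1 / h) := by positivity
    have hlogx : Real.log x = h * Real.log (x ^ (1 / h)) := by
      rw [Real.log_rpow hx0]
      field_simp
    have hlogc : Real.log (h ^ h * v) = h * Real.log (h * v ^ (1 / h)) := by
      rw [← Real.log_rpow (by positivity), Real.mul_rpow h0.le hb.le, root_pow hv]
    have hroot : x ^ (1 / h) ≤ u ^ (1 / h) + v ^ (1 / h) * Real.log x := by
      refine le_of_eq_of_le ?_ (Real.rpow_add_rpow_le_add ha (mul_nonneg hb.le hL) hh)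
      rw [Real.mul_rpow hb.le hL, root_pow hu, root_pow hv, ← hxeq]
    have key := lt_two_mul_of_le_add_mul_log (a := u ^ (1 / h)) (c := h * v ^ (1 / h))
      (by positivity) hy (by rw [hlogx] at hroot; linarith)
    rw [hlogc]
    linarith
end

section
/- Define c₁ = 2(|a| + |b|)/√Δ and c₂ = log*(c₁/|w|)/log|α|. If n ≥ m ≥ 0 and z₁, …, z_s are nonnegative integers with n > c₂ and u_n + u_m = w·p₁^{z₁}⋯p_s^{z_s}, then z_i < (2·log|α| / log p_i)·n for every 1 ≤ i ≤ s; in particular z_i < (2·log|α| / log 2)·n for every 1 ≤ i ≤ s. -/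
/-- The bound `(|a| + |b|) * |α| ^ n / |α - β|` for a Binet-type expression with `1 ≤ |α|`,
`|β| ≤ |α|` and index at most `n`. -/
theorem abs_binet_le {α β a b : ℝ} (hα : 1 ≤ |α|) (hβα : |β| ≤ |α|) {k n : ℕ} (hk : k ≤ n) :
    |(a * α ^ k - b * β ^ k) / (α - β)| ≤ (|a| + |b|) * |α| ^ n / |α - β| := by
  rw [abs_div]
  gcongr
  have hαk : |α| ^ k ≤ |α| ^ n := pow_le_pow_right₀ hα hk
  have hβk : |β| ^ k ≤ |α| ^ n := (pow_le_pow_left₀ (abs_nonneg β) hβα k).trans hαk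
  calc |a * α ^ k - b * β ^ k| ≤ |a * α ^ k| + |b * β ^ k| := abs_sub _ _
    _ = |a| * |α| ^ k + |b| * |β| ^ k := by simp only [abs_mul, abs_pow]
    _ ≤ |a| * |α| ^ n + |b| * |α| ^ n := by gcongr
    _ = (|a| + |b|) * |α| ^ n := by ring


/-- Lemma 2 (ii): upper bounds for the exponents `z_i` in terms of `n`. -/
theorem stmt_3 (A B : ℤ) (hA : A ≠ 0) (hB : B ≠ 0)
    (hΔ : (0:ℤ) < A ^ 2 + 4 * B)
    (α β : ℝ)
    (hαroot : α ^ 2 = A * α + B) (hβroot : β ^ 2 = A * β + B)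
    (hαβ : |β| < |α|)
    (u₀ u₁ : ℤ) (hu01 : u₀ ≠ 0 ∨ u₁ ≠ 0)
    (u : ℕ → ℤ)
    (hrec : ∀ n, u (n + 2) = A * u (n + 1) + B * u n)
    (a b : ℝ) (ha : a = (u₁ : ℝ) - u₀ * β) (hb : b = (u₁ : ℝ) - u₀ * α)
    (hbinet : ∀ n : ℕ, (u n : ℝ) = (a * α ^ n - b * β ^ n) / (α - β))
    (s : ℕ) (hs : 1 ≤ s)
    (p : Fin s → ℕ) (hp : ∀ i, (p i).Prime) (hpinj : Function.Injective p)
    (w : ℤ) (hw : w ≠ 0) (hpw : ∀ i, ¬ ((p i : ℤ) ∣ w))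
    (c₁ c₂ : ℝ)
    (hc₁ : c₁ = 2 * (|a| + |b|) / Real.sqrt ((A : ℝ) ^ 2 + 4 * B))
    (hc₂ : c₂ = max 0 (Real.log (c₁ / |(w : ℝ)|)) / Real.log |α|)
    (n m : ℕ) (hnm : m ≤ n) (z : Fin s → ℕ)
    (hn : c₂ < (n : ℝ))
    (heq : u n + u m = w * ∏ i, (p i : ℤ) ^ (z i)) :
    (∀ i, (z i : ℝ) < 2 * Real.log |α| / Real.log (p i) * n) ∧
    (∀ i, (z i : ℝ) < 2 * Real.log |α| / Real.log 2 * n) := by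
  have hne : α - β ≠ 0 := fun h => by
    rw [sub_eq_zero.mp h] at hαβ
    exact lt_irrefl _ hαβ
  have hsum : α + β = A := mul_left_cancel₀ hne (by linear_combination hαroot - hβroot)
  have hprod : α * β = -B := by linear_combination α * hsum - hαroot
  have hα1 : 1 < |α| := by
    have hB1 : (1 : ℝ) ≤ |(B : ℝ)| := by exact_mod_cast Int.one_le_abs hB
    have h : |α| * |β| = |(B : ℝ)| := by rw [← abs_mul, hprod, abs_neg]
    by_contra! hle
    nlinarith [abs_nonneg α, abs_nonneg β]
  have hsqrt : Real.sqrt ((A : ℝ) ^ 2 + 4 * B) = |α - β| := by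
    rw [← Real.sqrt_sq_eq_abs]
    congr 1
    linear_combination (-(A : ℝ) - α - β) * hsum + 4 * hprod
  have hlogα : 0 < Real.log |α| := Real.log_pos hα1
  have hw0 : 0 < |(w : ℝ)| := abs_pos.mpr (by exact_mod_cast hw)
  have hlogc : Real.log (c₁ / |(w : ℝ)|) < n * Real.log |α| := by
    rw [hc₂, div_lt_iff₀ hlogα] at hn
    exact (le_max_right _ _).trans_lt hn
  have hprodR : |(u n : ℝ) + u m| = |(w : ℝ)| * ∏ j, (p j : ℝ) ^ z j := by
    have h : (u n : ℝ) + u m = w * ∏ j, (p j : ℝ) ^ z j := by exact_mod_cast heq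
    rw [h, abs_mul, abs_of_nonneg (a := ∏ j, (p j : ℝ) ^ z j) (by positivity)]
  have hupper : ∏ j, (p j : ℝ) ^ z j ≤ c₁ / |(w : ℝ)| * |α| ^ n := by
    have h : |(u n : ℝ) + u m| ≤ c₁ * |α| ^ n := by
      rw [hc₁, hsqrt, hbinet n, hbinet m]
      refine (abs_add_le _ _).trans ((add_le_add (abs_binet_le hα1.le hαβ.le le_rfl)
        (abs_binet_le hα1.le hαβ.le hnm)).trans_eq ?_)
      ring
    rw [div_mul_eq_mul_div, le_div_iff₀ hw0, mul_comm, ← hprodR]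
    exact h
  have hmain : ∀ i, (z i : ℝ) * Real.log (p i) < 2 * Real.log |α| * n := by
    intro i
    have hone : ∀ j, (1 : ℝ) ≤ (p j : ℝ) ^ z j := fun j =>
      one_le_pow₀ (by exact_mod_cast (hp j).one_le)
    have hle : (p i : ℝ) ^ z i ≤ c₁ / |(w : ℝ)| * |α| ^ n := by
      refine le_trans ?_ hupper
      rw [← Finset.mul_prod_erase _ _ (Finset.mem_univ i)]
      exact le_mul_of_one_le_right (zero_le_one.trans (hone i))
        (Finset.prod_induction _ (1 ≤ ·) (fun _ _ => one_le_mul_of_one_le_of_one_le) le_rfl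
          fun j _ => hone j)
    have hpos : 0 < (p i : ℝ) ^ z i := zero_lt_one.trans_le (hone i)
    have hαn : 0 < |α| ^ n := by positivity
    have hc : 0 < c₁ / |(w : ℝ)| := pos_of_mul_pos_left (hpos.trans_le hle) hαn.le
    have hlog := Real.log_le_log hpos hle
    rw [Real.log_pow, Real.log_mul hc.ne' hαn.ne', Real.log_pow] at hlog
    linarith
  constructor
  · intro i
    rw [div_mul_eq_mul_div, lt_div_iff₀ (Real.log_pos (by exact_mod_cast (hp i).one_lt))]
    exact hmain i
  · intro i
    rw [div_mul_eq_mul_div, lt_div_iff₀ (Real.log_pos one_lt_two)]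
    have hlog2 : Real.log 2 ≤ Real.log (p i) :=
      Real.log_le_log two_pos (by exact_mod_cast (hp i).two_le)
    exact (mul_le_mul_of_nonneg_left hlog2 (Nat.cast_nonneg _)).trans_lt (hmain i)
end

section
/- Assume the sequence u is non-degenerate. Define c₃ = max{log*(4|b|φ/(|a|(φ−1)))/log|α|, log*(4|b|φ/(|a|(φ−1)))/log(|α|/|β|)} and c₄ = |a|(φ−1)/(2φ·√Δ). Then for all nonnegative integers n ≥ m with n > c₃ one has c₄·|α|^n < |u_n + u_m|. -/
/-- Vieta's formula for the sum of the two distinct roots of `x² - A x - B`. -/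
theorem add_eq_of_distinct_roots {A B α β : ℝ} (hα : α ^ 2 = A * α + B)
    (hβ : β ^ 2 = A * β + B) (hne : α ≠ β) : α + β = A :=
  mul_left_cancel₀ (sub_ne_zero.2 hne) (by linear_combination hα - hβ)

theorem abs_sub_eq_sqrt_discrim {A B α β : ℝ} (hα : α ^ 2 = A * α + B)
    (hβ : β ^ 2 = A * β + B) (hne : α ≠ β) : |α - β| = √(A ^ 2 + 4 * B) := by
  have hsum := add_eq_of_distinct_roots hα hβ hne
  rw [← Real.sqrt_sq_eq_abs]
  congr 1
  linear_combination 2 * hα + 2 * hβ - (α + β - A) * hsum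

theorem two_mul_abs_eq_abs_add_add_abs_sub {x y : ℝ} (h : |y| < |x|) :
    2 * |x| = |x + y| + |x - y| := by
  rcases abs_cases x with hx | hx <;> rcases abs_cases y with hy | hy <;>
    rcases abs_cases (x + y) with h₁ | h₁ <;> rcases abs_cases (x - y) with h₂ | h₂ <;> linarith

/-- The dominant root of an integral `x² - A x - B` with `A, B ≠ 0` and positive discriminant
has absolute value at least the golden ratio. -/
theorem goldenRatio_le_abs_dominant_root {A B : ℤ} (hA : A ≠ 0) (hB : B ≠ 0)
    (hΔ : 0 < A ^ 2 + 4 * B) {α β : ℝ} (hα : α ^ 2 = A * α + B) (hβ : β ^ 2 = A * β + B)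
    (hαβ : |β| < |α|) : (1 + √5) / 2 ≤ |α| := by
  have hne : α ≠ β := fun h => hαβ.ne (by rw [h])
  have hα2 := two_mul_abs_eq_abs_add_add_abs_sub hαβ
  rw [add_eq_of_distinct_roots hα hβ hne, abs_sub_eq_sqrt_discrim hα hβ hne] at hα2
  have hA1 : (1 : ℝ) ≤ |(A : ℝ)| := mod_cast Int.one_le_abs hA
  by_cases hA3 : 3 ≤ |A|
  · have hA3' : (3 : ℝ) ≤ |(A : ℝ)| := mod_cast hA3
    have hΔ1 : (1 : ℝ) ≤ √((A : ℝ) ^ 2 + 4 * B) := Real.one_le_sqrt.2 (mod_cast hΔ)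
    have h5 : √5 ≤ 3 := Real.sqrt_le_iff.2 (by norm_num)
    linarith
  · have hA2 : |A| ≤ 2 := by lia
    have hsq4 : A ^ 2 ≤ 4 := by nlinarith [sq_abs A, abs_nonneg A]
    have hsq1 : 0 < A ^ 2 := by positivity
    have hΔ5 : (5 : ℤ) ≤ A ^ 2 + 4 * B := by lia
    have h5 : √5 ≤ √((A : ℝ) ^ 2 + 4 * B) := Real.sqrt_le_sqrt (mod_cast hΔ5)
    linarith

/-- A bound `log* x / log y < n` yields `x < y ^ n`. -/
theorem lt_pow_of_max_log_div_log_lt {x y : ℝ} (hx : 0 < x) (hy : 1 < y) {n : ℕ}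
    (h : max 0 (Real.log x) / Real.log y < n) : x < y ^ n := by
  rw [div_lt_iff₀ (Real.log_pos hy), ← Real.log_pow] at h
  exact (Real.log_lt_log_iff hx (by positivity)).1 ((le_max_right _ _).trans_lt h)

theorem pow_le_max_one_pow {x : ℝ} (hx : 0 ≤ x) {m n : ℕ} (h : m ≤ n) :
    x ^ m ≤ max 1 (x ^ n) := by
  rcases le_total x 1 with h1 | h1
  · exact (pow_le_one₀ hx h1).trans (le_max_left _ _)
  · exact (pow_le_pow_right₀ h1 h).trans (le_max_right _ _)

theorem mul_abs_pow_le_abs_pow_add_pow {x p : ℝ} (hp : 1 < p) (hx : p ≤ |x|) {m n : ℕ}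
    (h : m ≤ n) : (p - 1) / p * |x| ^ n ≤ |x ^ n + x ^ m| := by
  have hp0 : 0 < p := by linarith
  have hr : (p - 1) / p = 1 - 1 / p := by field_simp
  have hn : 0 ≤ |x| ^ n := by positivity
  rcases h.eq_or_lt with rfl | hlt
  · rw [← two_mul, abs_mul, abs_pow, hr]
    have : 0 < 1 / p := by positivity
    rw [abs_two]
    gcongr
    linarith
  · have hm : |x| ^ m ≤ 1 / p * |x| ^ n := by
      rw [one_div_mul_eq_div, le_div_iff₀ hp0]
      calc |x| ^ m * p ≤ |x| ^ m * |x| := by gcongr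
        _ = |x| ^ (m + 1) := (pow_succ _ _).symm
        _ ≤ |x| ^ n := pow_le_pow_right₀ (by linarith) hlt
    have htri := abs_sub_abs_le_abs_sub (x ^ n) (-x ^ m)
    rw [abs_neg, sub_neg_eq_add, abs_pow, abs_pow] at htri
    rw [hr]
    linarith

/-- Lemma 2 (iii): lower bound `c₄·|α|^n < |u_n + u_m|` for `n > c₃`. -/
theorem stmt_4 (A B : ℤ) (hA : A ≠ 0) (hB : B ≠ 0)
    (hΔ : (0:ℤ) < A ^ 2 + 4 * B)
    (α β : ℝ)
    (hαroot : α ^ 2 = A * α + B) (hβroot : β ^ 2 = A * β + B)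
    (hαβ : |β| < |α|)
    (u₀ u₁ : ℤ) (hu01 : u₀ ≠ 0 ∨ u₁ ≠ 0)
    (u : ℕ → ℤ)
    (hrec : ∀ n, u (n + 2) = A * u (n + 1) + B * u n)
    (a b : ℝ) (ha : a = (u₁ : ℝ) - u₀ * β) (hb : b = (u₁ : ℝ) - u₀ * α)
    (hbinet : ∀ n : ℕ, (u n : ℝ) = (a * α ^ n - b * β ^ n) / (α - β))
    (hnd : a * b * α * β ≠ 0)
    (φ c₃ c₄ : ℝ) (hφ : φ = (1 + Real.sqrt 5) / 2)
    (hc₃ : c₃ = max (max 0 (Real.log (4 * |b| * φ / (|a| * (φ - 1)))) / Real.log |α|)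
                    (max 0 (Real.log (4 * |b| * φ / (|a| * (φ - 1)))) / Real.log (|α| / |β|)))
    (hc₄ : c₄ = |a| * (φ - 1) / (2 * φ * Real.sqrt ((A : ℝ) ^ 2 + 4 * B))) :
    ∀ n m : ℕ, m ≤ n → c₃ < (n : ℝ) →
      c₄ * |α| ^ n < |(u n : ℝ) + (u m : ℝ)| := by
  intro n m hmn hn
  have hne : α ≠ β := fun h => hαβ.ne (by rw [h])
  have ha0 : 0 < |a| := abs_pos.2 (by rintro rfl; simp at hnd)
  have hb0 : 0 < |b| := abs_pos.2 (by rintro rfl; simp at hnd)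
  have hβ0 : 0 < |β| := abs_pos.2 (by rintro rfl; simp at hnd)
  have hφα : φ ≤ |α| := hφ ▸ goldenRatio_le_abs_dominant_root hA hB hΔ hαroot hβroot hαβ
  have hφ1 : 1 < φ := hφ ▸ Real.one_lt_goldenRatio
  have hφ0 : 0 < φ - 1 := sub_pos.2 hφ1
  have hφpos : 0 < φ := by linarith
  have hX : 0 < 4 * |b| * φ / (|a| * (φ - 1)) := by positivity
  rw [hc₃, max_lt_iff] at hn
  have hα := lt_pow_of_max_log_div_log_lt hX (hφ1.trans_le hφα) hn.1
  have hβ := lt_pow_of_max_log_div_log_lt hX ((one_lt_div hβ0).2 hαβ) hn.2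
  rw [div_pow, lt_div_iff₀ (by positivity)] at hβ
  have hmax : 4 * |b| * φ / (|a| * (φ - 1)) * max 1 (|β| ^ n) < |α| ^ n := by
    rcases max_choice 1 (|β| ^ n) with h | h <;> rw [h] <;> linarith
  have hsmall : 2 * |b| * max 1 (|β| ^ n) < |a| * (φ - 1) / (2 * φ) * |α| ^ n := by
    calc 2 * |b| * max 1 (|β| ^ n)
        = |a| * (φ - 1) / (2 * φ) *
            (4 * |b| * φ / (|a| * (φ - 1)) * max 1 (|β| ^ n)) := by field_simp; norm_num
      _ < _ := by gcongr
  have hβsum : |b * (β ^ n + β ^ m)| ≤ 2 * |b| * max 1 (|β| ^ n) := by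
    rw [abs_mul, mul_comm 2, mul_assoc]
    gcongr
    calc |β ^ n + β ^ m| ≤ |β ^ n| + |β ^ m| := abs_add_le _ _
      _ = |β| ^ n + |β| ^ m := by rw [abs_pow, abs_pow]
      _ ≤ 2 * max 1 (|β| ^ n) := by
        linarith [le_max_right 1 (|β| ^ n), pow_le_max_one_pow hβ0.le hmn]
  have hαsum : |a| * ((φ - 1) / φ * |α| ^ n) ≤ |a * (α ^ n + α ^ m)| := by
    rw [abs_mul]
    gcongr
    exact mul_abs_pow_le_abs_pow_add_pow hφ1 hφα hmn
  have hsqrt := abs_sub_eq_sqrt_discrim hαroot hβroot hne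
  have hD : 0 < |α - β| := abs_pos.2 (sub_ne_zero.2 hne)
  have hsum : (u n : ℝ) + u m =
      (a * (α ^ n + α ^ m) - b * (β ^ n + β ^ m)) / (α - β) := by
    rw [hbinet, hbinet]
    ring
  have hhalf : |a| * ((φ - 1) / φ * |α| ^ n) = 2 * (|a| * (φ - 1) / (2 * φ) * |α| ^ n) := by
    field_simp
  have hc : c₄ * |α| ^ n = |a| * (φ - 1) / (2 * φ) * |α| ^ n / |α - β| := by
    rw [hc₄, ← hsqrt]
    field_simp
  rw [hsum, abs_div, hc]
  gcongr
  linarith [abs_sub_abs_le_abs_sub (a * (α ^ n + α ^ m)) (b * (β ^ n + β ^ m))]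
end

section
/- Assume the sequence u is non-degenerate. Define c₃ = max{log*(4|b|φ/(|a|(φ−1)))/log|α|, log*(4|b|φ/(|a|(φ−1)))/log(|α|/|β|)}, c₄ = |a|(φ−1)/(2φ·√Δ) and c₅ = log(|w|/c₄)/log|α|. If n ≥ m ≥ 0 and z₁, …, z_s are nonnegative integers with n > c₃ and u_n + u_m = w·p₁^{z₁}⋯p_s^{z_s}, then n < (z₁·log p₁ + ⋯ + z_s·log p_s)/log|α| + c₅. -/
/-- Vieta's formulas for two distinct roots of `x ^ 2 - A * x - B`. -/
lemma vieta_of_roots {A B α β : ℝ} (hα : α ^ 2 = A * α + B) (hβ : β ^ 2 = A * β + B)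
    (hne : α ≠ β) : α + β = A ∧ α * β = -B := by
  have h : α + β = A := by
    apply mul_right_cancel₀ (sub_ne_zero.mpr hne)
    linear_combination hα - hβ
  exact ⟨h, by linear_combination α * h - hα⟩

lemma abs_add_abs_sub_eq_two_mul_abs {α β : ℝ} (h : |β| < |α|) :
    |α + β| + |α - β| = 2 * |α| := by
  rcases abs_cases α with ⟨h₁, h₁'⟩ | ⟨h₁, h₁'⟩ <;>
  rcases abs_cases β with ⟨h₂, h₂'⟩ | ⟨h₂, h₂'⟩ <;>
  rcases abs_cases (α + β) with ⟨h₃, h₃'⟩ | ⟨h₃, h₃'⟩ <;>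
  rcases abs_cases (α - β) with ⟨h₄, h₄'⟩ | ⟨h₄, h₄'⟩ <;>
  linarith

/-- The golden ratio is the smallest possible dominant root of `x ^ 2 - A * x - B` with nonzero
integers `A` and `B` and positive discriminant. -/
lemma one_add_sqrt_five_le_abs_add_sqrt {A B : ℤ} (hA : A ≠ 0) (hB : B ≠ 0)
    (hΔ : 0 < A ^ 2 + 4 * B) :
    1 + √5 ≤ |(A : ℝ)| + √((A : ℝ) ^ 2 + 4 * B) := by
  have h5 : √5 ≤ 3 := Real.sqrt_le_iff.mpr (by norm_num)
  have hA1 : 1 ≤ |A| := Int.one_le_abs hA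
  have hsq : |A| ^ 2 = A ^ 2 := sq_abs A
  have key : ∀ k : ℝ, k ≤ ((A ^ 2 + 4 * B : ℤ) : ℝ) → √k ≤ √((A : ℝ) ^ 2 + 4 * B) :=
    fun k hk => Real.sqrt_le_sqrt (by push_cast at hk; exact hk)
  have hcast : |(A : ℝ)| = ((|A| : ℤ) : ℝ) := by push_cast; rfl
  rw [hcast]
  obtain h | h | h : |A| = 1 ∨ |A| = 2 ∨ 3 ≤ |A| := by omega
  · have hΔ' : (5 : ℤ) ≤ A ^ 2 + 4 * B := by rw [← hsq, h] at hΔ ⊢; omega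
    have := key 5 (by exact_mod_cast hΔ')
    rw [h]; push_cast; linarith
  · have hΔ' : (4 : ℤ) ≤ A ^ 2 + 4 * B := by rw [← hsq, h] at hΔ ⊢; omega
    have := key 4 (by exact_mod_cast hΔ')
    have h4 : √(4 : ℝ) = 2 := by
      rw [show (4 : ℝ) = 2 ^ 2 by norm_num]; exact Real.sqrt_sq (by norm_num)
    rw [h]; push_cast; linarith
  · have := key 1 (by exact_mod_cast hΔ)
    rw [Real.sqrt_one] at this
    have h3 : (3 : ℝ) ≤ ((|A| : ℤ) : ℝ) := by exact_mod_cast h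
    linarith

/-- The sum of two powers of `α` loses at most the factor `(c - 1) / c` when `c ≤ |α|`. -/
lemma mul_sub_one_div_le_abs_pow_add_pow {α c : ℝ} (hc : 1 ≤ c) (hα : c ≤ |α|) {m n : ℕ}
    (hmn : m ≤ n) : |α| ^ n * ((c - 1) / c) ≤ |α ^ n + α ^ m| := by
  have hc0 : 0 < c := by linarith
  have hfrac : (c - 1) / c = 1 - 1 / c := by field_simp
  have hpow : 0 ≤ |α| ^ n := by positivity
  rcases hmn.eq_or_lt with rfl | hlt
  · rw [← two_mul, abs_mul, abs_pow, abs_two, hfrac]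
    have : 0 ≤ 1 / c := by positivity
    nlinarith
  · have h1 : |α| ^ m * c ≤ |α| ^ n :=
      calc |α| ^ m * c ≤ |α| ^ m * |α| := by gcongr
        _ = |α| ^ (m + 1) := (pow_succ _ _).symm
        _ ≤ |α| ^ n := pow_le_pow_right₀ (hc.trans hα) hlt
    have h2 : |α| ^ m ≤ |α| ^ n * (1 / c) := by
      rw [mul_one_div, le_div_iff₀ hc0]; exact h1
    have h3 : |α ^ n| - |α ^ m| ≤ |α ^ n + α ^ m| := by
      simpa using abs_sub_abs_le_abs_sub (α ^ n) (-α ^ m)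
    rw [abs_pow, abs_pow] at h3
    rw [hfrac]; linarith

lemma lt_pow_of_logStar_div_log_lt {K x : ℝ} (hK : 0 < K) (hx : 1 < x) {n : ℕ}
    (h : max 0 (Real.log K) / Real.log x < n) : K < x ^ n := by
  rw [div_lt_iff₀ (Real.log_pos hx)] at h
  rw [← Real.log_lt_log_iff hK (by positivity), Real.log_pow]
  exact (le_max_right _ _).trans_lt h

/-- Powers of `β` are dominated by powers of `α` beyond an explicit exponent. -/
lemma mul_abs_pow_add_pow_lt {α β K : ℝ} (hα : 1 < |α|) (hβ : β ≠ 0) (hαβ : |β| < |α|)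
    (hK : 0 < K) {m n : ℕ} (hmn : m ≤ n)
    (h₁ : max 0 (Real.log K) / Real.log |α| < n)
    (h₂ : max 0 (Real.log K) / Real.log (|α| / |β|) < n) :
    K * |β ^ n + β ^ m| < 2 * |α| ^ n := by
  have hβ0 : 0 < |β| := abs_pos.mpr hβ
  have hadd : |β ^ n + β ^ m| ≤ |β| ^ n + |β| ^ m := by
    simpa only [abs_pow] using abs_add_le (β ^ n) (β ^ m)
  rcases le_total |β| 1 with hβ1 | hβ1
  · have h := lt_pow_of_logStar_div_log_lt hK hα h₁
    have hn : |β| ^ n ≤ 1 := pow_le_one₀ hβ0.le hβ1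
    have hm : |β| ^ m ≤ 1 := pow_le_one₀ hβ0.le hβ1
    nlinarith
  · have h := lt_pow_of_logStar_div_log_lt hK ((one_lt_div hβ0).mpr hαβ) h₂
    rw [div_pow, lt_div_iff₀ (by positivity)] at h
    have hm : |β| ^ m ≤ |β| ^ n := pow_le_pow_right₀ hβ1 hmn
    nlinarith

/-- Lemma 2 (iv): upper bound for `n` in terms of the exponents `z_i`. -/
theorem stmt_5 (A B : ℤ) (hA : A ≠ 0) (hB : B ≠ 0)
    (hΔ : (0:ℤ) < A ^ 2 + 4 * B)
    (α β : ℝ)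
    (hαroot : α ^ 2 = A * α + B) (hβroot : β ^ 2 = A * β + B)
    (hαβ : |β| < |α|)
    (u₀ u₁ : ℤ) (hu01 : u₀ ≠ 0 ∨ u₁ ≠ 0)
    (u : ℕ → ℤ)
    (hrec : ∀ n, u (n + 2) = A * u (n + 1) + B * u n)
    (a b : ℝ) (ha : a = (u₁ : ℝ) - u₀ * β) (hb : b = (u₁ : ℝ) - u₀ * α)
    (hbinet : ∀ n : ℕ, (u n : ℝ) = (a * α ^ n - b * β ^ n) / (α - β))
    (hnd : a * b * α * β ≠ 0)
    (s : ℕ) (hs : 1 ≤ s)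
    (p : Fin s → ℕ) (hp : ∀ i, (p i).Prime) (hpinj : Function.Injective p)
    (w : ℤ) (hw : w ≠ 0) (hpw : ∀ i, ¬ ((p i : ℤ) ∣ w))
    (φ c₃ c₄ c₅ : ℝ) (hφ : φ = (1 + Real.sqrt 5) / 2)
    (hc₃ : c₃ = max (max 0 (Real.log (4 * |b| * φ / (|a| * (φ - 1)))) / Real.log |α|)
                    (max 0 (Real.log (4 * |b| * φ / (|a| * (φ - 1)))) / Real.log (|α| / |β|)))
    (hc₄ : c₄ = |a| * (φ - 1) / (2 * φ * Real.sqrt ((A : ℝ) ^ 2 + 4 * B)))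
    (hc₅ : c₅ = Real.log (|(w : ℝ)| / c₄) / Real.log |α|)
    (n m : ℕ) (hnm : m ≤ n) (z : Fin s → ℕ)
    (hn : c₃ < (n : ℝ))
    (heq : u n + u m = w * ∏ i, (p i : ℤ) ^ (z i)) :
    (n : ℝ) < (∑ i, (z i : ℝ) * Real.log (p i)) / Real.log |α| + c₅ := by
  obtain ⟨⟨⟨ha0, hb0⟩, hα0⟩, hβ0⟩ : ((a ≠ 0 ∧ b ≠ 0) ∧ α ≠ 0) ∧ β ≠ 0 := by
    simpa only [mul_ne_zero_iff] using hnd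
  have hne : α ≠ β := fun h => by simp [h] at hαβ
  obtain ⟨hsum, hprod⟩ := vieta_of_roots hαroot hβroot hne
  have hΔeq : (A : ℝ) ^ 2 + 4 * B = (α - β) ^ 2 := by
    rw [← hsum]; linear_combination 4 * hprod
  have hsqrt : √((A : ℝ) ^ 2 + 4 * B) = |α - β| := by rw [hΔeq, Real.sqrt_sq_eq_abs]
  have hφα : φ ≤ |α| := by
    have h₁ := one_add_sqrt_five_le_abs_add_sqrt hA hB hΔ
    have h₂ := abs_add_abs_sub_eq_two_mul_abs hαβ
    rw [hsqrt, ← hsum] at h₁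
    rw [hφ]; linarith
  have hφ1 : 1 < φ := hφ ▸ Real.one_lt_goldenRatio
  have hφ1' : 0 < φ - 1 := sub_pos.mpr hφ1
  have hφ0 : 0 < φ := by linarith
  have hα1 : 1 < |α| := hφ1.trans_le hφα
  have ha' : 0 < |a| := abs_pos.mpr ha0
  have hb' : 0 < |b| := abs_pos.mpr hb0
  have hD : 0 < |α - β| := abs_pos.mpr (sub_ne_zero.mpr hne)
  have hlogα : 0 < Real.log |α| := Real.log_pos hα1
  rw [hsqrt] at hc₄
  have hc₄0 : 0 < c₄ := by rw [hc₄]; positivity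
  rw [hc₃, max_lt_iff] at hn
  have hβpow := mul_abs_pow_add_pow_lt hα1 hβ0 hαβ
    (K := 4 * |b| * φ / (|a| * (φ - 1))) (by positivity) hnm hn.1 hn.2
  have hαpow := mul_sub_one_div_le_abs_pow_add_pow hφ1.le hφα hnm
  have hlower : c₄ * |α| ^ n < |((u n + u m : ℤ) : ℝ)| := by
    have hu : ((u n + u m : ℤ) : ℝ) = (a * (α ^ n + α ^ m) - b * (β ^ n + β ^ m)) / (α - β) := by
      push_cast; rw [hbinet, hbinet]; ring
    have htri := abs_sub_abs_le_abs_sub (a * (α ^ n + α ^ m)) (b * (β ^ n + β ^ m))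
    rw [abs_mul, abs_mul] at htri
    have hA' := mul_le_mul_of_nonneg_left hαpow ha'.le
    have hB' : |b| * |β ^ n + β ^ m| < |a| * (|α| ^ n * ((φ - 1) / φ)) / 2 := by
      rw [div_mul_eq_mul_div, div_lt_iff₀ (by positivity)] at hβpow
      rw [show |a| * (|α| ^ n * ((φ - 1) / φ)) / 2 = |a| * |α| ^ n * (φ - 1) / (2 * φ) by
        field_simp, lt_div_iff₀ (by positivity)]
      linarith
    rw [hu, abs_div, lt_div_iff₀ hD, hc₄,
      show |a| * (φ - 1) / (2 * φ * |α - β|) * |α| ^ n * |α - β|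
        = |a| * (|α| ^ n * ((φ - 1) / φ)) / 2 by field_simp]
    linarith
  have hw0 : 0 < |(w : ℝ)| := abs_pos.mpr (Int.cast_ne_zero.mpr hw)
  have hp0 : ∀ i, (0 : ℝ) < p i := fun i => Nat.cast_pos.mpr (hp i).pos
  have hP0 : 0 < ∏ i, (p i : ℝ) ^ z i := Finset.prod_pos fun i _ => pow_pos (hp0 i) _
  have habs : |((u n + u m : ℤ) : ℝ)| = |(w : ℝ)| * ∏ i, (p i : ℝ) ^ z i := by
    rw [heq]; push_cast; rw [abs_mul, abs_of_pos hP0]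
  have hlogP : Real.log (∏ i, (p i : ℝ) ^ z i) = ∑ i, (z i : ℝ) * Real.log (p i) := by
    rw [Real.log_prod fun i _ => (pow_pos (hp0 i) _).ne']
    simp only [Real.log_pow]
  have hlog := Real.log_lt_log (by positivity) hlower
  rw [habs, Real.log_mul hc₄0.ne' (by positivity), Real.log_pow,
    Real.log_mul hw0.ne' hP0.ne', hlogP] at hlog
  rw [hc₅, ← add_div, lt_div_iff₀ hlogα, Real.log_div hw0.ne' hc₄0.ne']
  linarith
end

section
/- Let A and B be nonzero integers with A² + 4B > 0, and let α and β be the two real roots of the polynomial x² − A·x − B. Then max{|α|, |β|} ≥ (1+√5)/2. -/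
theorem abs_add_add_abs_sub_le_two_mul_max (x y : ℝ) :
    |x + y| + |x - y| ≤ 2 * max |x| |y| := by
  have hx := le_max_left |x| |y|
  have hy := le_max_right |x| |y|
  rcases abs_cases (x + y) with h | h <;> rcases abs_cases (x - y) with h' | h' <;>
    linarith [le_abs_self x, neg_abs_le x, le_abs_self y, neg_abs_le y]

theorem three_le_abs_of_discrim_lt_five {A B : ℤ} (hA : A ≠ 0) (hB : B ≠ 0)
    (hpos : 0 < A ^ 2 + 4 * B) (hlt : A ^ 2 + 4 * B < 5) : 3 ≤ |A| := by
  by_contra! h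
  obtain ⟨h₁, h₂⟩ := abs_lt.mp h
  interval_cases A <;> omega

/-- the dominant root of `x² − Ax − B` (with `A, B` nonzero integers and
positive discriminant) has absolute value at least the golden ratio. -/
theorem stmt_7 (A B : ℤ) (hA : A ≠ 0) (hB : B ≠ 0)
    (hΔ : (0:ℤ) < A ^ 2 + 4 * B)
    (α β : ℝ) (hsum : α + β = A) (hprod : α * β = -B) :
    (1 + Real.sqrt 5) / 2 ≤ max |α| |β| := by
  have hmax := abs_add_add_abs_sub_le_two_mul_max α β
  have hdiscrim : (α - β) ^ 2 = ((A ^ 2 + 4 * B : ℤ) : ℝ) := by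
    push_cast
    linear_combination (α + β + A) * hsum - 4 * hprod
  rw [hsum] at hmax
  rcases le_or_gt 5 (A ^ 2 + 4 * B) with h | h
  · have hA' : (1 : ℝ) ≤ |(A : ℝ)| := by exact_mod_cast Int.one_le_abs hA
    have hsub : √5 ≤ |α - β| := by
      rw [← Real.sqrt_sq_eq_abs, hdiscrim]
      exact Real.sqrt_le_sqrt (by exact_mod_cast h)
    linarith
  · have hA' : (3 : ℝ) ≤ |(A : ℝ)| := by
      exact_mod_cast three_le_abs_of_discrim_lt_five hA hB hΔ h
    have hsub : 1 ≤ |α - β| := by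
      rw [← one_le_sq_iff_one_le_abs, hdiscrim]
      exact_mod_cast hΔ
    have hsqrt : √5 ≤ 3 := Real.sqrt_le_iff.mpr ⟨by norm_num, by norm_num⟩
    linarith
end

section
/- Assume the sequence u is non-degenerate and that p_i does not divide gcd(A,B) for any 1 ≤ i ≤ s. Then there exists a real constant C (depending only on A, B, u₀, u₁, w, s and p₁, …, p_s) such that every tuple (n, z₁, …, z_s) of nonnegative integers with u_n = w·p₁^{z₁}⋯p_s^{z_s} satisfies n < C and z_i < C for every 1 ≤ i ≤ s. -/
open Finset in
theorem sub_pow_dvd_sum_of_sum_mul_choose_eq_zero {R : Type*} [CommRing R] (X Y : R)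
    (c : ℕ → ℤ) (N M : ℕ)
    (hc : ∀ k < M, ∑ j ∈ range (N + 1), c j * (j.choose k : ℤ) = 0) :
    (X - Y) ^ M ∣ ∑ j ∈ range (N + 1), (c j : R) * X ^ (N - j) * Y ^ j := by
  have expand : ∀ j ∈ range (N + 1), (c j : R) * X ^ (N - j) * Y ^ j =
      ∑ k ∈ range (N + 1), (Y - X) ^ k * X ^ (N - k) * ((c j * (j.choose k : ℤ) : ℤ) : R) := by
    intro j hj
    have hjN : j ≤ N := Nat.lt_succ_iff.mp (mem_range.mp hj)
    have h1 : Y ^ j = ∑ k ∈ range (N + 1), (Y - X) ^ k * X ^ (j - k) * (j.choose k : R) := by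
      conv_lhs => rw [← sub_add_cancel Y X, add_pow]
      apply sum_subset (range_mono (by omega))
      intro k _ hk
      rw [Nat.choose_eq_zero_of_lt (by simpa using hk)]
      simp
    rw [h1, mul_sum]
    refine sum_congr rfl fun k _ => ?_
    by_cases hkj : k ≤ j
    · have : N - k = (N - j) + (j - k) := by omega
      rw [this, pow_add]
      push_cast
      ring
    · rw [Nat.choose_eq_zero_of_lt (by omega)]
      simp
  rw [sum_congr rfl expand, sum_comm]
  refine dvd_sum fun k _ => ?_
  rw [← mul_sum, ← Int.cast_sum]
  by_cases hk : k < M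
  · simp [hc k hk]
  · refine Dvd.dvd.mul_right (Dvd.dvd.mul_right ?_ _) _
    exact (pow_dvd_pow (X - Y) (by omega)).trans
      (pow_dvd_pow_of_dvd (by rw [← neg_sub X Y, dvd_neg]) k)

open Finset in
theorem alternating_sum_choose_mul_eval_eq_zero (N : ℕ) (P : Polynomial ℤ)
    (hP : P.natDegree < N) :
    ∑ j ∈ range (N + 1), (-1) ^ j * (N.choose j : ℤ) * P.eval (j : ℤ) = 0 := by
  have h := congrFun (Polynomial.fwdDiff_iter_eq_zero_of_degree_lt hP) 0
  rw [fwdDiff_iter_eq_sum_shift] at h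
  have h2 : ∑ j ∈ range (N + 1), (-1) ^ j * (N.choose j : ℤ) * P.eval (j : ℤ) =
      (-1) ^ N * ∑ k ∈ range (N + 1), ((-1 : ℤ) ^ (N - k) * N.choose k) •
        P.eval (0 + k • (1 : ℤ)) := by
    rw [mul_sum]
    refine sum_congr rfl fun k hk => ?_
    have hk : k ≤ N := Nat.lt_succ_iff.mp (mem_range.mp hk)
    have : (-1 : ℤ) ^ N * (-1) ^ (N - k) = (-1) ^ k := by
      rw [← pow_add, show N + (N - k) = k + 2 * (N - k) by omega, pow_add, pow_mul]
      simp
    simp only [smul_eq_mul, zero_add, nsmul_eq_mul, mul_one]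
    rw [← this]
    ring
  rw [h2, h]
  simp

/-- Coefficients of the Padé numerator. -/
def padeCoeff (r d j : ℕ) : ℤ :=
  (-1) ^ j * (((r + 1 + 2 * d).choose j * (r + d - j).choose r : ℕ) : ℤ)

/-- The homogeneous polynomial `P` of degree `d` for which `X ^ (r + 1 + d) * P X Y` and
`Y ^ (r + 1 + d) * P Y X` agree to order `2 * d + 1` along `X = Y`. -/
def padeForm {R : Type*} [CommRing R] (r d : ℕ) (X Y : R) : R :=
  ∑ j ∈ Finset.range (d + 1), (padeCoeff r d j : R) * X ^ (d - j) * Y ^ j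

theorem ringChoose_sub_reflect (r d j : ℕ) (hj : j ≤ d) :
    Ring.choose (((r + d : ℕ) : ℤ) - ((r + 1 + 2 * d - j : ℕ) : ℤ)) r =
      (-1) ^ r * ((r + d - j).choose r : ℤ) := by
  rw [show (((r + d : ℕ) : ℤ) - ((r + 1 + 2 * d - j : ℕ) : ℤ)) = -((d - j + 1 : ℕ) : ℤ) by omega,
    Ring.choose_neg,
    show (((d - j + 1 : ℕ) : ℤ) + (r : ℤ) - 1) = ((r + d - j : ℕ) : ℤ) by omega,
    Ring.choose_natCast]
  simp [Int.negOnePow_def, Units.smul_def]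

open Finset in
theorem sum_alternating_choose_mul_ringChoose (r d k : ℕ) (hk : k < 2 * d + 1) :
    ∑ j ∈ range (r + 1 + 2 * d + 1), ((-1) ^ j * ((r + 1 + 2 * d).choose j : ℤ) *
      Ring.choose (((r + d : ℕ) : ℤ) - (j : ℤ)) r) * (j.choose k : ℤ) = 0 := by
  set P : Polynomial ℤ := descPochhammer ℤ k *
    (descPochhammer ℤ r).comp (Polynomial.C ((r + d : ℕ) : ℤ) - Polynomial.X) with hP
  have hdeg : P.natDegree < r + 1 + 2 * d := by
    have h1 : (Polynomial.C ((r + d : ℕ) : ℤ) - Polynomial.X).natDegree ≤ 1 := by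
      compute_degree
    have h2 := Polynomial.natDegree_mul_le (p := descPochhammer ℤ k)
      (q := (descPochhammer ℤ r).comp (Polynomial.C ((r + d : ℕ) : ℤ) - Polynomial.X))
    rw [Polynomial.natDegree_comp, descPochhammer_natDegree, descPochhammer_natDegree] at h2
    have := Nat.mul_le_mul_left r h1
    rw [← hP] at h2
    omega
  have h := alternating_sum_choose_mul_eval_eq_zero _ P hdeg
  have ev : ∀ (n : ℕ) (x : ℤ), (descPochhammer ℤ n).eval x = n.factorial * Ring.choose x n := by
    intro n x
    rw [Polynomial.eval_eq_smeval, Ring.descPochhammer_eq_factorial_smul_choose]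
    simp
  have h3 : ((k.factorial * r.factorial : ℕ) : ℤ) *
    ∑ j ∈ range (r + 1 + 2 * d + 1), ((-1) ^ j * ((r + 1 + 2 * d).choose j : ℤ) *
      Ring.choose (((r + d : ℕ) : ℤ) - (j : ℤ)) r) * (j.choose k : ℤ) = 0 := by
    rw [← h, mul_sum]
    refine sum_congr rfl fun j _ => ?_
    rw [hP, Polynomial.eval_mul, Polynomial.eval_comp, ev, ev, Ring.choose_natCast]
    simp only [Polynomial.eval_sub, Polynomial.eval_C, Polynomial.eval_X]
    push_cast
    ring
  exact (mul_eq_zero.mp h3).resolve_left (by positivity)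

open Finset in
theorem sub_pow_dvd_padeForm {R : Type*} [CommRing R] (r d : ℕ) (X Y : R) :
    (X - Y) ^ (2 * d + 1) ∣
      X ^ (r + 1 + d) * padeForm r d X Y - Y ^ (r + 1 + d) * padeForm r d Y X := by
  have h := sub_pow_dvd_sum_of_sum_mul_choose_eq_zero X Y _ _ _
    (sum_alternating_choose_mul_ringChoose r d)
  convert h using 1
  set c : ℕ → ℤ := fun j => (-1) ^ j * ((r + 1 + 2 * d).choose j : ℤ) *
      Ring.choose (((r + d : ℕ) : ℤ) - (j : ℤ)) r with hc
  have clow : ∀ j ≤ d, c j = padeCoeff r d j := by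
    intro j hj
    simp only [hc, padeCoeff]
    rw [← Nat.cast_sub (by omega), Ring.choose_natCast]
    push_cast
    ring
  have cmid : ∀ j, d < j → j ≤ r + d → c j = 0 := by
    intro j hj hj'
    simp only [hc]
    rw [← Nat.cast_sub (by omega), Ring.choose_natCast,
      Nat.choose_eq_zero_of_lt (show r + d - j < r by omega)]
    simp
  have chigh : ∀ j ≤ d, c (r + 1 + 2 * d - j) = - padeCoeff r d j := by
    intro j hj
    simp only [hc, padeCoeff]
    rw [ringChoose_sub_reflect r d j hj, Nat.choose_symm (by omega)]
    have : (-1 : ℤ) ^ (r + 1 + 2 * d - j) * (-1) ^ r = - (-1) ^ j := by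
      rw [← pow_add, show r + 1 + 2 * d - j + r = j + 1 + 2 * (r + d - j) by omega, pow_add,
        pow_mul]
      simp [pow_succ]
    push_cast
    linear_combination ((r + 1 + 2 * d).choose j : ℤ) * ((r + d - j).choose r : ℤ) * this
  change _ = ∑ j ∈ range (r + 1 + 2 * d + 1), (c j : R) * X ^ (r + 1 + 2 * d - j) * Y ^ j
  rw [show r + 1 + 2 * d + 1 = (d + 1) + (r + (d + 1)) by ring, sum_range_add,
    sum_range_add _ r, sub_eq_add_neg]
  congr 1
  · rw [padeForm, mul_sum]
    refine sum_congr rfl fun j hj => ?_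
    have hj : j ≤ d := Nat.lt_succ_iff.mp (mem_range.mp hj)
    rw [clow j hj, show r + 1 + 2 * d - j = (r + 1 + d) + (d - j) by omega, pow_add]
    ring
  · rw [sum_eq_zero (s := range r), zero_add, ← sum_range_reflect, padeForm, mul_sum,
      ← sum_neg_distrib]
    · refine sum_congr rfl fun j hj => ?_
      have hj : j ≤ d := Nat.lt_succ_iff.mp (mem_range.mp hj)
      rw [show d + 1 + (r + (d + 1 - 1 - j)) = r + 1 + 2 * d - j by omega, chigh j hj,
        show r + 1 + 2 * d - (r + 1 + 2 * d - j) = j by omega,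
        show r + 1 + 2 * d - j = (r + 1 + d) + (d - j) by omega, pow_add]
      push_cast
      ring
    · intro j hj
      rw [cmid _ (by omega) (by have := mem_range.mp hj; omega)]
      simp

theorem map_padeForm {R S : Type*} [CommRing R] [CommRing S] (f : R →+* S) (r d : ℕ) (X Y : R) :
    f (padeForm r d X Y) = padeForm r d (f X) (f Y) := by
  simp [padeForm]

theorem padeForm_mul_mul {R : Type*} [CommRing R] (r d : ℕ) (t X Y : R) :
    padeForm r d (t * X) (t * Y) = t ^ d * padeForm r d X Y := by
  rw [padeForm, padeForm, Finset.mul_sum]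
  refine Finset.sum_congr rfl fun j hj => ?_
  have hj : j ≤ d := Nat.lt_succ_iff.mp (Finset.mem_range.mp hj)
  rw [mul_pow, mul_pow, ← Nat.sub_add_cancel hj, pow_add t, Nat.sub_add_cancel hj]
  ring

theorem padeForm_zero_one {R : Type*} [CommRing R] (r d : ℕ) :
    padeForm r d (0 : R) 1 = (-1) ^ d * ((r + 1 + 2 * d).choose d : R) := by
  rw [padeForm, Finset.sum_range_succ, Finset.sum_eq_zero]
  · simp [padeCoeff]
  · intro j hj
    have := Finset.mem_range.mp hj
    rw [zero_pow (by omega)]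
    simp

theorem padeForm_one_zero {R : Type*} [CommRing R] (r d : ℕ) :
    padeForm r d (1 : R) 0 = ((r + d).choose r : R) := by
  rw [padeForm, Finset.sum_range_succ', Finset.sum_eq_zero]
  · simp [padeCoeff]
  · intro j _
    simp

open Polynomial in
theorem natDegree_padeForm_le {R : Type*} [CommRing R] (r d : ℕ) (p q : R[X])
    (hp : p.natDegree ≤ 1) (hq : q.natDegree ≤ 1) : (padeForm r d p q).natDegree ≤ d := by
  refine natDegree_sum_le_of_forall_le _ _ fun j hj => ?_
  have hj : j ≤ d := Nat.lt_succ_iff.mp (Finset.mem_range.mp hj)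
  have h1 := natDegree_pow_le_of_le (d - j) hp
  have h2 := natDegree_pow_le_of_le j hq
  have h3 : ((padeCoeff r d j : ℤ) : R[X]).natDegree ≤ 0 := by simp
  have := natDegree_mul_le_of_le (natDegree_mul_le_of_le h3 h1) h2
  omega

open Polynomial in
theorem padeForm_det_ne_zero {K : Type*} [Field K] [CharZero K] (r d : ℕ) (X Y : K)
    (hY : Y ≠ 0) (hXY : X ≠ Y) :
    padeForm (r + 1) d X Y * padeForm r (d + 1) Y X -
      padeForm r (d + 1) X Y * padeForm (r + 1) d Y X ≠ 0 := by
  set D : K[X] := padeForm (r + 1) d Polynomial.X 1 * padeForm r (d + 1) 1 Polynomial.X -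
    padeForm r (d + 1) Polynomial.X 1 * padeForm (r + 1) d 1 Polynomial.X with hD
  have hdvd : (Polynomial.X - 1 : K[X]) ^ (2 * d + 1) ∣ D := by
    have h1 := sub_pow_dvd_padeForm (r + 1) d (Polynomial.X : K[X]) 1
    have h2 := (pow_dvd_pow (Polynomial.X - 1 : K[X])
      (show 2 * d + 1 ≤ 2 * (d + 1) + 1 by omega)).trans
      (sub_pow_dvd_padeForm r (d + 1) (Polynomial.X : K[X]) 1)
    have h3 : (Polynomial.X - 1 : K[X]) ^ (2 * d + 1) ∣ Polynomial.X ^ (r + 2 + d) * D := by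
      have h := dvd_sub (h1.mul_right (padeForm r (d + 1) 1 Polynomial.X))
        (h2.mul_right (padeForm (r + 1) d 1 Polynomial.X))
      convert h using 1
      rw [hD, show r + 1 + 1 + d = r + 2 + d by ring, show r + 1 + (d + 1) = r + 2 + d by ring]
      ring
    refine IsCoprime.dvd_of_dvd_mul_left (IsCoprime.pow ?_) h3
    exact ⟨-1, 1, by ring⟩
  have hdeg : D.natDegree ≤ 2 * d + 1 := by
    have hX : (Polynomial.X : K[X]).natDegree ≤ 1 := natDegree_X_le
    have h1 : (1 : K[X]).natDegree ≤ 1 := by simp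
    refine (natDegree_sub_le_of_le
      (natDegree_mul_le_of_le (natDegree_padeForm_le _ _ _ _ hX h1)
        (natDegree_padeForm_le _ _ _ _ h1 hX))
      (natDegree_mul_le_of_le (natDegree_padeForm_le _ _ _ _ hX h1)
        (natDegree_padeForm_le _ _ _ _ h1 hX))).trans ?_
    omega
  obtain ⟨g, hg⟩ := hdvd
  have ev : ∀ t : K, D.eval t = padeForm (r + 1) d t 1 * padeForm r (d + 1) 1 t -
      padeForm r (d + 1) t 1 * padeForm (r + 1) d 1 t := by
    intro t
    have := fun r d p q => map_padeForm (evalRingHom t) r d p q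
    simp only [coe_evalRingHom] at this
    simp [hD, this]
  have hD0 : D.eval 0 ≠ 0 := by
    rw [ev, padeForm_zero_one, padeForm_zero_one, padeForm_one_zero, padeForm_one_zero]
    have hpos : 0 < (r + 1 + 1 + 2 * d).choose d * (r + (d + 1)).choose r +
        (r + 1 + 2 * (d + 1)).choose (d + 1) * (r + 1 + d).choose (r + 1) :=
      Nat.add_pos_left (Nat.mul_pos (Nat.choose_pos (by omega)) (Nat.choose_pos (by omega))) _
    have hne : (((r + 1 + 1 + 2 * d).choose d * (r + (d + 1)).choose r +
        (r + 1 + 2 * (d + 1)).choose (d + 1) * (r + 1 + d).choose (r + 1) : ℕ) : K) ≠ 0 := by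
      exact_mod_cast hpos.ne'
    have := mul_ne_zero (pow_ne_zero d (neg_ne_zero.mpr (one_ne_zero (α := K)))) hne
    convert this using 1
    push_cast
    ring
  have hg0 : g ≠ 0 := by
    rintro rfl
    simp [hg] at hD0
  have hgdeg : g.natDegree = 0 := by
    have hm : (Polynomial.X - 1 : K[X]).Monic := by simpa using monic_X_sub_C (1 : K)
    rw [hg, (hm.pow _).natDegree_mul' hg0, hm.natDegree_pow] at hdeg
    have : (Polynomial.X - 1 : K[X]).natDegree = 1 := by simpa using natDegree_X_sub_C (1 : K)
    rw [this] at hdeg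
    omega
  rw [eq_C_of_natDegree_eq_zero hgdeg] at hg
  have hc : g.coeff 0 ≠ 0 := by
    intro h
    simp [hg, h] at hD0
  have ht : D.eval (X / Y) ≠ 0 := by
    rw [hg]
    simp only [eval_mul, eval_pow, eval_sub, eval_X, eval_one, eval_C]
    refine mul_ne_zero (pow_ne_zero _ (sub_ne_zero.mpr fun h => hXY ?_)) hc
    rwa [div_eq_one_iff_eq hY] at h
  rw [ev] at ht
  have h1 : ∀ r d, padeForm r d X Y = Y ^ d * padeForm r d (X / Y) 1 := by
    intro r d
    rw [← padeForm_mul_mul, mul_one, mul_div_cancel₀ _ hY]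
  have h2 : ∀ r d, padeForm r d Y X = Y ^ d * padeForm r d 1 (X / Y) := by
    intro r d
    rw [← padeForm_mul_mul, mul_one, mul_div_cancel₀ _ hY]
  rw [h1, h1, h2, h2]
  convert mul_ne_zero (pow_ne_zero (2 * d + 1) hY) ht using 1
  ring

theorem abs_padeForm_le (r d : ℕ) (X Y W : ℝ) (hX : |X| ≤ W) (hY : |Y| ≤ W) :
    |padeForm r d X Y| ≤ 16 ^ (r + 1 + d) * W ^ d := by
  have hW : 0 ≤ W := (abs_nonneg X).trans hX
  have hterm : ∀ j ∈ Finset.range (d + 1),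
      |(padeCoeff r d j : ℝ) * X ^ (d - j) * Y ^ j| ≤ 8 ^ (r + 1 + d) * W ^ d := by
    intro j hj
    have hj : j ≤ d := Nat.lt_succ_iff.mp (Finset.mem_range.mp hj)
    have hc : |(padeCoeff r d j : ℝ)| ≤ 8 ^ (r + 1 + d) := by
      have h : (r + 1 + 2 * d).choose j * (r + d - j).choose r ≤ 8 ^ (r + 1 + d) :=
        calc (r + 1 + 2 * d).choose j * (r + d - j).choose r
            ≤ 2 ^ (r + 1 + 2 * d) * 2 ^ (r + d - j) :=
              Nat.mul_le_mul (Nat.choose_le_two_pow _ _) (Nat.choose_le_two_pow _ _)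
          _ = 2 ^ ((r + 1 + 2 * d) + (r + d - j)) := (pow_add _ _ _).symm
          _ ≤ 2 ^ (3 * (r + 1 + d)) := Nat.pow_le_pow_right (by norm_num) (by omega)
          _ = 8 ^ (r + 1 + d) := by rw [pow_mul]; norm_num
      rw [padeCoeff]
      push_cast
      rw [abs_mul, abs_pow, abs_neg, abs_one, one_pow, one_mul, abs_of_nonneg (by positivity)]
      exact_mod_cast h
    rw [abs_mul, abs_mul, abs_pow, abs_pow, mul_assoc]
    gcongr
    calc |X| ^ (d - j) * |Y| ^ j ≤ W ^ (d - j) * W ^ j := by gcongr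
      _ = W ^ d := by rw [← pow_add, Nat.sub_add_cancel hj]
  calc |padeForm r d X Y| ≤ ∑ j ∈ Finset.range (d + 1), 8 ^ (r + 1 + d) * W ^ d :=
        (Finset.abs_sum_le_sum_abs _ _).trans (Finset.sum_le_sum hterm)
    _ = ((d + 1 : ℕ) : ℝ) * (8 ^ (r + 1 + d) * W ^ d) := by
        rw [Finset.sum_const, Finset.card_range, nsmul_eq_mul]
    _ ≤ 2 ^ (r + 1 + d) * (8 ^ (r + 1 + d) * W ^ d) := by
        gcongr
        have : d + 1 ≤ 2 ^ (r + 1 + d) :=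
          (show d + 1 ≤ r + 1 + d by omega).trans (Nat.lt_two_pow_self).le
        exact_mod_cast this
    _ = 16 ^ (r + 1 + d) * W ^ d := by
        rw [← mul_assoc, ← mul_pow]
        norm_num

theorem binet_of_add_of_mul {R : Type*} [CommRing R] {A B : ℤ} {u : ℕ → ℤ}
    (hrec : ∀ n, u (n + 2) = A * u (n + 1) + B * u n) {x y : R}
    (hadd : x + y = A) (hmul : x * y = -B) (n : ℕ) :
    ((u 1 : R) - u 0 * y) * x ^ n - ((u 1 : R) - u 0 * x) * y ^ n = (x - y) * u n := by
  induction n using Nat.twoStepInduction with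
  | zero => ring
  | one => ring
  | more n ih₀ ih₁ =>
    rw [hrec]
    push_cast
    have hx : x ^ 2 = A * x + B := by linear_combination x * hadd - hmul
    have hy : y ^ 2 = A * y + B := by linear_combination y * hadd - hmul
    linear_combination (A : R) * ih₁ + (B : R) * ih₀ + ((u 1 : R) - u 0 * y) * x ^ n * hx -
      ((u 1 : R) - u 0 * x) * y ^ n * hy

/-- One half of the determinant of the Padé relation at index `n` and the Binet relation at index
`(r + 1 + d) * n + e`; the other half is obtained by exchanging `x` and `y`. -/
def minorHalf {R : Type*} [CommRing R] (u : ℕ → ℤ) (r d e n : ℕ) (x y : R) : R :=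
  ((u 1 : R) - u 0 * y) ^ (r + d) * y ^ e *
    padeForm r d (((u 1 : R) - u 0 * y) * x ^ n) (((u 1 : R) - u 0 * x) * y ^ n)

theorem map_minorHalf {R S : Type*} [CommRing R] [CommRing S] (f : R →+* S) (u : ℕ → ℤ)
    (r d e n : ℕ) (x y : R) :
    f (minorHalf u r d e n x y) = minorHalf u r d e n (f x) (f y) := by
  simp [minorHalf, map_padeForm]

/-- The constant `a * b` of the recurrence, which satisfies
`u (n + 1) ^ 2 - A * u (n + 1) * u n - B * u n ^ 2 = (-B) ^ n * recNorm A B u`. -/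
def recNorm (A B : ℤ) (u : ℕ → ℤ) : ℤ := u 1 ^ 2 - A * u 1 * u 0 - B * u 0 ^ 2

theorem mul_eq_recNorm {R : Type*} [CommRing R] {A B : ℤ} (u : ℕ → ℤ) {x y : R}
    (hadd : x + y = A) (hmul : x * y = -B) :
    ((u 1 : R) - u 0 * y) * ((u 1 : R) - u 0 * x) = recNorm A B u := by
  rw [recNorm]
  push_cast
  linear_combination -(u 1 : R) * u 0 * hadd + (u 0 : R) ^ 2 * hmul

theorem dvd_minor {R : Type*} [CommRing R] {A B : ℤ} {u : ℕ → ℤ}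
    (hrec : ∀ n, u (n + 2) = A * u (n + 1) + B * u n) {x y : R}
    (hadd : x + y = A) (hmul : x * y = -B) (r d e n : ℕ) (m : ℤ)
    (h₁ : m ∣ u n ^ (2 * d + 1)) (h₂ : m ∣ u ((r + 1 + d) * n + e)) :
    (m : R) ∣ (recNorm A B u : R) ^ (r + 1 + d) * (-(B : R)) ^ (n * (r + 1 + d)) *
      (minorHalf u r d e n x y - minorHalf u r d e n y x) := by
  have hx := binet_of_add_of_mul hrec hadd hmul
  rw [← mul_eq_recNorm u hadd hmul, ← hmul]
  set a : R := (u 1 : R) - u 0 * y with ha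
  set b : R := (u 1 : R) - u 0 * x with hb
  obtain ⟨g, hg⟩ := sub_pow_dvd_padeForm r d (a * x ^ n) (b * y ^ n)
  rw [hx, mul_pow (x - y)] at hg
  have h₁' : (m : R) ∣ (a * x ^ n) ^ (r + 1 + d) * padeForm r d (a * x ^ n) (b * y ^ n) -
      (b * y ^ n) ^ (r + 1 + d) * padeForm r d (b * y ^ n) (a * x ^ n) := by
    rw [hg]
    refine Dvd.dvd.mul_right (Dvd.dvd.mul_left ?_ _) _
    exact_mod_cast (Int.castRingHom R).map_dvd h₁
  have h₂' : (m : R) ∣ a * x ^ ((r + 1 + d) * n + e) - b * y ^ ((r + 1 + d) * n + e) := by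
    rw [hx]
    exact Dvd.dvd.mul_left ((Int.castRingHom R).map_dvd h₂) _
  have key : (a * b) ^ (r + 1 + d) * (x * y) ^ (n * (r + 1 + d)) *
      (minorHalf u r d e n x y - minorHalf u r d e n y x) =
      (b * y ^ n) ^ (r + 1 + d) * (a ^ (r + d) * y ^ e *
        ((a * x ^ n) ^ (r + 1 + d) * padeForm r d (a * x ^ n) (b * y ^ n) -
      (b * y ^ n) ^ (r + 1 + d) * padeForm r d (b * y ^ n) (a * x ^ n)) -
      padeForm r d (b * y ^ n) (a * x ^ n) * (a * b) ^ (r + d) *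
        (a * x ^ ((r + 1 + d) * n + e) - b * y ^ ((r + 1 + d) * n + e))) := by
    simp only [minorHalf, ← ha, ← hb]
    generalize padeForm r d (a * x ^ n) (b * y ^ n) = P
    generalize padeForm r d (b * y ^ n) (a * x ^ n) = Q
    rw [show r + 1 + d = r + d + 1 by ring]
    generalize r + d = k
    simp only [mul_pow, pow_add, ← pow_mul, mul_comm n, pow_one]
    ring
  rw [key]
  exact Dvd.dvd.mul_left (dvd_sub (h₁'.mul_left _) (h₂'.mul_left _)) _

theorem exists_int_minor {A B : ℤ} {u : ℕ → ℤ}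
    (hrec : ∀ n, u (n + 2) = A * u (n + 1) + B * u n) {α β : ℝ}
    (hadd : α + β = A) (hmul : α * β = -B) (r d e n : ℕ) (m : ℤ) (hm : IsCoprime m B)
    (h₁ : m ∣ u n ^ (2 * d + 1)) (h₂ : m ∣ u ((r + 1 + d) * n + e)) :
    ∃ s : ℤ, minorHalf u r d e n α β - minorHalf u r d e n β α = s * (α - β) ∧
      m ∣ s * (A ^ 2 + 4 * B) * recNorm A B u ^ (r + 1 + d) := by
  let ω : QuadraticAlgebra ℤ B A := ⟨0, 1⟩
  let f : QuadraticAlgebra ℤ B A →ₐ[ℤ] ℝ :=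
    QuadraticAlgebra.lift ⟨α, by
      simp only [zsmul_eq_mul, mul_one]
      linear_combination α * hadd - hmul⟩
  have hfω : f ω = α := by simp [f, ω, QuadraticAlgebra.lift]
  have hωadd : ω + star ω = (A : QuadraticAlgebra ℤ B A) := by
    ext <;> simp [ω]
  have hωmul : ω * star ω = -(B : QuadraticAlgebra ℤ B A) := by
    ext <;> simp [ω]
  have hfω' : f (star ω) = β := by
    have h := congrArg f hωadd
    rw [map_add, hfω, map_intCast] at h
    linarith
  set E := minorHalf u r d e n ω (star ω) with hE
  have hEstar : minorHalf u r d e n (star ω) ω = star E := by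
    have := map_minorHalf (starRingEnd (QuadraticAlgebra ℤ B A)) u r d e n ω (star ω)
    simpa [starRingEnd_apply] using this.symm
  have hsub : E - star E = (E.im : QuadraticAlgebra ℤ B A) * (ω - star ω) := by
    ext <;> simp [ω] <;> ring
  refine ⟨E.im, ?_, ?_⟩
  · have h := congrArg f hsub
    rw [← hEstar, map_sub, map_mul, map_sub, map_intCast, hfω, hfω'] at h
    rw [← h, hE]
    have := map_minorHalf (f : QuadraticAlgebra ℤ B A →+* ℝ) u r d e n
    simp only [RingHom.coe_coe] at this
    rw [this, this, hfω, hfω']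
  · have h := dvd_minor hrec hωadd hωmul r d e n m h₁ h₂
    rw [hEstar, ← hE, hsub] at h
    have h := h.mul_right (ω - star ω)
    have hsq : (ω - star ω) * (ω - star ω) = ((A ^ 2 + 4 * B : ℤ) : QuadraticAlgebra ℤ B A) := by
      push_cast
      linear_combination (ω + star ω + A) * hωadd - 4 * hωmul
    have hint : (recNorm A B u : QuadraticAlgebra ℤ B A) ^ (r + 1 + d) *
        (-(B : QuadraticAlgebra ℤ B A)) ^ (n * (r + 1 + d)) *
          ((E.im : QuadraticAlgebra ℤ B A) * (ω - star ω)) * (ω - star ω) =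
        ((E.im * (A ^ 2 + 4 * B) * recNorm A B u ^ (r + 1 + d) * (-B) ^ (n * (r + 1 + d)) : ℤ) :
          QuadraticAlgebra ℤ B A) := by
      rw [mul_assoc, mul_assoc (E.im : QuadraticAlgebra ℤ B A), hsq]
      push_cast
      ring
    rw [hint] at h
    have h : m ∣ E.im * (A ^ 2 + 4 * B) * recNorm A B u ^ (r + 1 + d) * (-B) ^ (n * (r + 1 + d)) :=
      QuadraticAlgebra.algebraMap_dvd_iff_dvd.mp h
    exact (hm.neg_right.pow_right).dvd_of_dvd_mul_right h

theorem abs_minorHalf_le (u : ℕ → ℤ) (r d e n : ℕ) {x y c t : ℝ} (hc : 1 ≤ c)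
    (ha : |(u 1 : ℝ) - u 0 * y| ≤ c) (hb : |(u 1 : ℝ) - u 0 * x| ≤ c)
    (hx : |x| ≤ t) (hy : |y| ≤ t) :
    |minorHalf u r d e n x y| ≤ (16 * c ^ 2) ^ (r + 1 + d) * t ^ (e + d * n) := by
  have ht : 0 ≤ t := (abs_nonneg x).trans hx
  have h := abs_padeForm_le r d (((u 1 : ℝ) - u 0 * y) * x ^ n) (((u 1 : ℝ) - u 0 * x) * y ^ n)
    (c * t ^ n) (by rw [abs_mul, abs_pow]; gcongr) (by rw [abs_mul, abs_pow]; gcongr)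
  rw [minorHalf, abs_mul, abs_mul, abs_pow, abs_pow]
  calc _ ≤ c ^ (r + d) * t ^ e * (16 ^ (r + 1 + d) * (c * t ^ n) ^ d) := by gcongr
    _ = 16 ^ (r + 1 + d) * (c ^ (r + d) * c ^ d) * t ^ (e + d * n) := by
        rw [mul_pow, ← pow_mul, pow_add t, mul_comm d n]
        ring
    _ ≤ 16 ^ (r + 1 + d) * c ^ (2 * (r + 1 + d)) * t ^ (e + d * n) := by
        gcongr
        rw [← pow_add]
        exact pow_le_pow_right₀ hc (by omega)
    _ = _ := by rw [mul_pow, ← pow_mul]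

theorem minor_ne_zero_or {A B : ℤ} {u : ℕ → ℤ}
    (hrec : ∀ n, u (n + 2) = A * u (n + 1) + B * u n) {α β : ℝ}
    (hadd : α + β = A) (hmul : α * β = -B) (hne : α ≠ β) (hβ : β ≠ 0)
    (ha : (u 1 : ℝ) - u 0 * β ≠ 0) (hb : (u 1 : ℝ) - u 0 * α ≠ 0)
    (r d e n : ℕ) (hn : u n ≠ 0) :
    minorHalf u (r + 1) d e n α β - minorHalf u (r + 1) d e n β α ≠ 0 ∨
      minorHalf u r (d + 1) e n α β - minorHalf u r (d + 1) e n β α ≠ 0 := by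
  by_contra! h
  obtain ⟨h₁, h₂⟩ := h
  simp only [minorHalf] at h₁ h₂
  have hXY := binet_of_add_of_mul hrec hadd hmul n
  have hdet := padeForm_det_ne_zero r d (((u 1 : ℝ) - u 0 * β) * α ^ n)
    (((u 1 : ℝ) - u 0 * α) * β ^ n) (mul_ne_zero hb (pow_ne_zero _ hβ)) (by
      rw [← sub_ne_zero, hXY]
      exact mul_ne_zero (sub_ne_zero.mpr hne) (by exact_mod_cast hn))
  rw [show r + 1 + d = r + (d + 1) by ring] at h₁
  refine mul_ne_zero (mul_ne_zero (pow_ne_zero (r + (d + 1)) ha) (pow_ne_zero e hβ)) hdet ?_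
  linear_combination
    padeForm r (d + 1) (((u 1 : ℝ) - u 0 * α) * β ^ n) (((u 1 : ℝ) - u 0 * β) * α ^ n) * h₁ -
    padeForm (r + 1) d (((u 1 : ℝ) - u 0 * α) * β ^ n) (((u 1 : ℝ) - u 0 * β) * α ^ n) * h₂

theorem abs_le_of_dvd_of_dvd {A B : ℤ} {u : ℕ → ℤ}
    (hrec : ∀ n, u (n + 2) = A * u (n + 1) + B * u n) (hΔ : 0 < A ^ 2 + 4 * B) {α β : ℝ}
    (hadd : α + β = A) (hmul : α * β = -B) (hαβ : |β| < |α|) (hβ : β ≠ 0)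
    (ha : (u 1 : ℝ) - u 0 * β ≠ 0) (hb : (u 1 : ℝ) - u 0 * α ≠ 0) :
    ∃ C : ℝ, 1 ≤ C ∧ ∀ (r d e n : ℕ) (m : ℤ), IsCoprime m B → u n ≠ 0 → m ∣ u n ^ (2 * d + 1) →
      m ∣ u ((r + 2 + d) * n + e) → |(m : ℝ)| ≤ C ^ (r + 2 + d) * |α| ^ (e + (d + 1) * n) := by
  have hne : α ≠ β := by
    rintro rfl
    exact lt_irrefl _ hαβ
  have hα0 : 0 < |α| := (abs_nonneg β).trans_lt hαβ
  set c : ℝ := |(u 1 : ℝ) - u 0 * β| + |(u 1 : ℝ) - u 0 * α| + 1 with hc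
  have hac : |(u 1 : ℝ) - u 0 * β| ≤ c := by
    have := abs_nonneg ((u 1 : ℝ) - u 0 * α)
    linarith
  have hbc : |(u 1 : ℝ) - u 0 * α| ≤ c := by
    have := abs_nonneg ((u 1 : ℝ) - u 0 * β)
    linarith
  have hc1 : 1 ≤ c := by
    have := abs_nonneg ((u 1 : ℝ) - u 0 * β)
    have := abs_nonneg ((u 1 : ℝ) - u 0 * α)
    linarith
  have hN : recNorm A B u ≠ 0 := by
    intro h
    have := mul_eq_recNorm u hadd hmul
    rw [h, Int.cast_zero] at this
    exact mul_ne_zero ha hb this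
  have hN1 : (1 : ℝ) ≤ |(recNorm A B u : ℝ)| := by exact_mod_cast Int.one_le_abs hN
  have hΔ1 : (1 : ℝ) ≤ ((A ^ 2 + 4 * B : ℤ) : ℝ) := by exact_mod_cast hΔ
  have hΔeq : (α - β) ^ 2 = ((A ^ 2 + 4 * B : ℤ) : ℝ) := by
    push_cast
    linear_combination (α + β + A) * hadd - 4 * hmul
  have hαβ1 : 1 ≤ |α - β| := by
    rw [← one_le_sq_iff_one_le_abs, hΔeq]
    exact hΔ1
  have hα1 : 1 ≤ |α| := by
    have hB : B ≠ 0 := by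
      rintro rfl
      simp only [Int.cast_zero, neg_zero, mul_eq_zero] at hmul
      rcases hmul with h | h
      · rw [h, abs_zero] at hα0
        exact lt_irrefl _ hα0
      · exact hβ h
    have hB1 : (1 : ℝ) ≤ |(B : ℝ)| := by exact_mod_cast Int.one_le_abs hB
    have : |α| * |β| = |(B : ℝ)| := by rw [← abs_mul, hmul, abs_neg]
    nlinarith [abs_nonneg β]
  have main : ∀ (r d e n : ℕ) (m : ℤ), IsCoprime m B → m ∣ u n ^ (2 * d + 1) →
      m ∣ u ((r + 1 + d) * n + e) →
      minorHalf u r d e n α β - minorHalf u r d e n β α ≠ 0 →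
      |(m : ℝ)| ≤ (32 * c ^ 2 * ((A ^ 2 + 4 * B : ℤ) : ℝ) * |(recNorm A B u : ℝ)|) ^ (r + 1 + d) *
        |α| ^ (e + d * n) := by
    intro r d e n m hm h₁ h₂ hD
    obtain ⟨s, hs, hdvd⟩ := exists_int_minor hrec hadd hmul r d e n m hm h₁ h₂
    have hs0 : s ≠ 0 := by
      rintro rfl
      rw [hs, Int.cast_zero, zero_mul] at hD
      exact hD rfl
    have hs_le : |(s : ℝ)| ≤ (32 * c ^ 2) ^ (r + 1 + d) * |α| ^ (e + d * n) := by
      calc |(s : ℝ)| ≤ |(s : ℝ)| * |α - β| := le_mul_of_one_le_right (abs_nonneg _) hαβ1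
        _ = |minorHalf u r d e n α β - minorHalf u r d e n β α| := by rw [hs, abs_mul]
        _ ≤ |minorHalf u r d e n α β| + |minorHalf u r d e n β α| := abs_sub _ _
        _ ≤ (16 * c ^ 2) ^ (r + 1 + d) * |α| ^ (e + d * n) +
            (16 * c ^ 2) ^ (r + 1 + d) * |α| ^ (e + d * n) :=
          add_le_add (abs_minorHalf_le u r d e n hc1 hac hbc le_rfl hαβ.le)
            (abs_minorHalf_le u r d e n hc1 hbc hac hαβ.le le_rfl)
        _ = 2 * (16 * c ^ 2) ^ (r + 1 + d) * |α| ^ (e + d * n) := by ring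
        _ ≤ 2 ^ (r + 1 + d) * (16 * c ^ 2) ^ (r + 1 + d) * |α| ^ (e + d * n) := by
          gcongr
          exact le_self_pow₀ (by norm_num) (by omega)
        _ = _ := by
          rw [← mul_pow]
          ring
    have hne0 : s * (A ^ 2 + 4 * B) * recNorm A B u ^ (r + 1 + d) ≠ 0 :=
      mul_ne_zero (mul_ne_zero hs0 hΔ.ne') (pow_ne_zero _ hN)
    have hle : |m| ≤ |s * (A ^ 2 + 4 * B) * recNorm A B u ^ (r + 1 + d)| := by
      have := Int.natAbs_le_of_dvd_ne_zero hdvd hne0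
      rw [Int.abs_eq_natAbs, Int.abs_eq_natAbs]
      exact_mod_cast this
    have hle' : |(m : ℝ)| ≤
        |(s : ℝ)| * ((A ^ 2 + 4 * B : ℤ) : ℝ) * |(recNorm A B u : ℝ)| ^ (r + 1 + d) := by
      have h : ((|m| : ℤ) : ℝ) ≤
        ((|s * (A ^ 2 + 4 * B) * recNorm A B u ^ (r + 1 + d)| : ℤ) : ℝ) := by exact_mod_cast hle
      rw [abs_mul, abs_mul, abs_pow, abs_of_pos hΔ] at h
      rw [Int.cast_mul, Int.cast_mul, Int.cast_pow] at h
      simpa only [Int.cast_abs] using h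
    calc |(m : ℝ)| ≤ _ := hle'
      _ ≤ ((32 * c ^ 2) ^ (r + 1 + d) * |α| ^ (e + d * n)) *
          ((A ^ 2 + 4 * B : ℤ) : ℝ) ^ (r + 1 + d) * |(recNorm A B u : ℝ)| ^ (r + 1 + d) := by
        gcongr
        exact le_self_pow₀ hΔ1 (by omega)
      _ = _ := by
        rw [mul_pow _ |(recNorm A B u : ℝ)|, mul_pow _ ((A ^ 2 + 4 * B : ℤ) : ℝ)]
        ring
  refine ⟨32 * c ^ 2 * ((A ^ 2 + 4 * B : ℤ) : ℝ) * |(recNorm A B u : ℝ)|, ?_, ?_⟩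
  · have h1 : (1 : ℝ) ≤ 32 * c ^ 2 := by nlinarith
    exact one_le_mul_of_one_le_of_one_le (one_le_mul_of_one_le_of_one_le h1 hΔ1) hN1
  · intro r d e n m hm hn h₁ h₂
    rcases minor_ne_zero_or hrec hadd hmul hne hβ ha hb r d e n hn with h | h
    · rw [show r + 2 + d = r + 1 + 1 + d by ring] at h₂ ⊢
      refine (main (r + 1) d e n m hm h₁ h₂ h).trans ?_
      gcongr
      omega
    · rw [show r + 2 + d = r + 1 + (d + 1) by ring] at h₂ ⊢
      exact main r (d + 1) e n m hm (h₁.trans (pow_dvd_pow _ (by omega))) h₂ h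

theorem exists_abs_le_and_le_abs {A B : ℤ} {u : ℕ → ℤ}
    (hrec : ∀ n, u (n + 2) = A * u (n + 1) + B * u n) {α β : ℝ}
    (hadd : α + β = A) (hmul : α * β = -B) (hαβ : |β| < |α|)
    (ha : (u 1 : ℝ) - u 0 * β ≠ 0) :
    ∃ c : ℝ, 1 ≤ c ∧ (∀ n, |(u n : ℝ)| ≤ c * |α| ^ n) ∧
      ∀ᶠ n in Filter.atTop, |α| ^ n ≤ c * |(u n : ℝ)| := by
  have hα0 : 0 < |α| := (abs_nonneg β).trans_lt hαβ
  have hne : α - β ≠ 0 := by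
    rw [sub_ne_zero]
    rintro rfl
    exact lt_irrefl _ hαβ
  have hD : 0 < |α - β| := abs_pos.mpr hne
  have hbin := binet_of_add_of_mul hrec hadd hmul
  set a : ℝ := (u 1 : ℝ) - u 0 * β
  set b : ℝ := (u 1 : ℝ) - u 0 * α
  have ha0 : 0 < |a| := abs_pos.mpr ha
  refine ⟨max 1 (max ((|a| + |b|) / |α - β|) (2 * |α - β| / |a|)), le_max_left _ _, ?_, ?_⟩
  · intro n
    have h1 : |(u n : ℝ)| ≤ (|a| + |b|) / |α - β| * |α| ^ n := by
      rw [div_mul_eq_mul_div, le_div_iff₀ hD, mul_comm, ← abs_mul, ← hbin]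
      calc |a * α ^ n - b * β ^ n| ≤ |a * α ^ n| + |b * β ^ n| := abs_sub _ _
        _ = |a| * |α| ^ n + |b| * |β| ^ n := by rw [abs_mul, abs_mul, abs_pow, abs_pow]
        _ ≤ |a| * |α| ^ n + |b| * |α| ^ n := by gcongr
        _ = _ := by ring
    refine h1.trans ?_
    gcongr
    exact (le_max_left _ _).trans (le_max_right _ _)
  · have hlim : Filter.Tendsto (fun n : ℕ => 2 * |b| * (|β| / |α|) ^ n) Filter.atTop (nhds 0) := by
      have := (tendsto_pow_atTop_nhds_zero_of_lt_one (by positivity : 0 ≤ |β| / |α|)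
        ((div_lt_one hα0).mpr hαβ)).const_mul (2 * |b|)
      simpa using this
    filter_upwards [hlim.eventually_le_const ha0] with n hn
    rw [div_pow, ← mul_div_assoc, div_le_iff₀ (pow_pos hα0 n)] at hn
    have h1 : |a| * |α| ^ n - |b| * |β| ^ n ≤ |α - β| * |(u n : ℝ)| := by
      rw [← abs_mul, ← hbin, ← abs_pow, ← abs_pow, ← abs_mul, ← abs_mul]
      exact abs_sub_abs_le_abs_sub _ _
    have h2 : |α| ^ n ≤ 2 * |α - β| / |a| * |(u n : ℝ)| := by
      rw [div_mul_eq_mul_div, le_div_iff₀ ha0]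
      linarith
    refine h2.trans ?_
    gcongr
    exact (le_max_right _ _).trans (le_max_right _ _)

open Filter in
/-- Pigeonhole on the directions `z / n` of a family of exponent vectors. -/
theorem exists_frequently_div_eq {ι : Type*} [Fintype ι] {T : ℕ → (ι → ℕ) → Prop} (κ K : ℕ)
    (hT : ∃ᶠ n in atTop, ∃ z, T n z) (hκ : ∀ n z, 0 < n → T n z → ∀ i, z i ≤ κ * n) :
    ∃ v : ι → ℕ, ∃ᶠ n in atTop, ∃ z, T n z ∧ ∀ i, K * z i / n = v i := by
  by_contra h
  simp only [not_exists, not_frequently] at h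
  have h1 : ∀ v : ι → Fin (K * κ + 1), ∀ᶠ n in atTop,
      ∀ z, ¬ (T n z ∧ ∀ i, K * z i / n = (v i : ℕ)) := fun v => h _
  rw [← eventually_all] at h1
  refine hT ?_
  filter_upwards [h1, eventually_gt_atTop 0] with n hn hn0
  rintro ⟨z, hz⟩
  refine hn (fun i => ⟨K * z i / n, ?_⟩) z ⟨hz, fun i => rfl⟩
  rw [Nat.lt_succ_iff, Nat.div_le_iff_le_mul_add_pred hn0]
  have := Nat.mul_le_mul_left K (hκ n z hn0 hz i)
  calc K * z i ≤ K * (κ * n) := this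
    _ ≤ n * (K * κ) + (n - 1) := by
      rw [show K * (κ * n) = n * (K * κ) by ring]
      omega

/-- The exponent comparison which makes two solutions in the same direction incompatible. -/
theorem le_add_of_div_eq {K z₁ z₂ n₁ n₂ L M : ℕ} (hK : 0 < K) (hn₁ : 0 < n₁)
    (h : K * z₁ / n₁ = K * z₂ / n₂) (hL : L * n₁ ≤ n₂) (hM : M ≤ L) :
    M * z₁ ≤ z₂ + (n₂ / K + 1) := by
  set f := K * z₁ / n₁ with hf
  have h1 : K * z₁ ≤ (f + 1) * n₁ := by
    have := Nat.lt_div_mul_add hn₁ (a := K * z₁)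
    rw [← hf] at this
    nlinarith
  have h2 : f * n₂ ≤ K * z₂ := by
    rw [h]
    exact Nat.div_mul_le_self _ _
  have h3 : n₂ ≤ K * (n₂ / K + 1) := (Nat.lt_mul_div_succ n₂ hK).le
  refine Nat.le_of_mul_le_mul_left (c := K) ?_ hK
  calc K * (M * z₁) = M * (K * z₁) := by ring
    _ ≤ L * ((f + 1) * n₁) := Nat.mul_le_mul hM h1
    _ = (f + 1) * (L * n₁) := by ring
    _ ≤ (f + 1) * n₂ := Nat.mul_le_mul_left _ hL
    _ = f * n₂ + n₂ := by ring
    _ ≤ K * z₂ + K * (n₂ / K + 1) := add_le_add h2 h3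
    _ = _ := by ring

/-- The numerical estimate showing that two indices `n₁` and `n₂`, the second much larger than the
first, both satisfying the logarithmic divisibility bound, force `n₁` to be bounded. -/
theorem mul_le_of_log_le {l c q : ℝ} {K n₁ n₂ : ℕ} (hl : 0 < l) (hK : 0 < K)
    (hq0 : 0 ≤ q) (hq : 16 * q ≤ K * l) (hn₁ : 0 < n₁) (h40 : 40 * n₁ ≤ n₂)
    (h : n₁ * (2 * (n₂ / n₁ / 4) + 1 : ℕ) * l ≤ (n₂ / n₁ : ℕ) * c + (n₂ / K + 1 : ℕ) * q +
      (n₂ % n₁ + (n₂ / n₁ / 4 + 1) * n₁ : ℕ) * l) :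
    n₁ * l ≤ 8 * (c + K * l) := by
  have hmod : n₂ = n₁ * (n₂ / n₁) + n₂ % n₁ := (Nat.div_add_mod n₂ n₁).symm
  have hL : 40 ≤ n₂ / n₁ := (Nat.le_div_iff_mul_le hn₁).mpr h40
  have he : n₂ % n₁ ≤ n₁ := (Nat.mod_lt _ hn₁).le
  have hT : ((n₂ / K : ℕ) : ℝ) * K ≤ n₂ := by exact_mod_cast Nat.div_mul_le_self n₂ K
  generalize n₂ / K = T at *
  generalize n₂ % n₁ = e at *
  generalize n₂ / n₁ = L at *
  have hd : L ≤ 4 * (L / 4) + 3 := by omega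
  generalize L / 4 = d at *
  have hL' : (40 : ℝ) ≤ L := by exact_mod_cast hL
  have he' : (e : ℝ) ≤ n₁ := by exact_mod_cast he
  have hd' : (L : ℝ) ≤ 4 * d + 3 := by exact_mod_cast hd
  have hn₂ : (n₂ : ℝ) = n₁ * L + e := by exact_mod_cast hmod
  have hK' : (1 : ℝ) ≤ K := by exact_mod_cast hK
  have hn₁' : (0 : ℝ) < n₁ := by exact_mod_cast hn₁
  push_cast at h
  have h1 : 16 * ((T + 1) * q) ≤ (n₁ * L + n₁ + K) * l := by
    calc 16 * ((T + 1) * q) = (T + 1) * (16 * q) := by ring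
      _ ≤ (T + 1) * (K * l) := by gcongr
      _ = (T * K + K) * l := by ring
      _ ≤ (n₁ * L + n₁ + K) * l := by gcongr; linarith
  have h2 : (e + (d + 1) * n₁) * l ≤ (n₁ + (d + 1) * n₁) * l := by gcongr
  have hx : 0 < n₁ * l := by positivity
  have h3 : n₁ * l * (L - 7) ≤ n₁ * l * (4 * d - 4) :=
    mul_le_mul_of_nonneg_left (by linarith) hx.le
  have h4 : n₁ * l * (2 * L) ≤ n₁ * l * (3 * L - 29) :=
    mul_le_mul_of_nonneg_left (by linarith) hx.le
  have hKl : K * l ≤ L * (K * l) := le_mul_of_one_le_left (by positivity) (by linarith)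
  have h5 : L * (n₁ * l) ≤ L * (8 * (c + K * l)) := by nlinarith
  exact le_of_mul_le_mul_left h5 (by linarith)

open Filter in
/-- Far out in a non-degenerate recurrence sequence, no term is, up to a bounded factor, a product
of powers of fixed integers coprime to `B`. -/
theorem eventually_forall_prod_pow_dvd_imp_lt {ι : Type*} [Fintype ι] {A B : ℤ} {u : ℕ → ℤ}
    (hrec : ∀ n, u (n + 2) = A * u (n + 1) + B * u n) (hΔ : 0 < A ^ 2 + 4 * B) {α β : ℝ}
    (hadd : α + β = A) (hmul : α * β = -B) (hαβ : |β| < |α|) (hβ : β ≠ 0)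
    (ha : (u 1 : ℝ) - u 0 * β ≠ 0) (hb : (u 1 : ℝ) - u 0 * α ≠ 0)
    {p : ι → ℕ} (hp : ∀ i, 2 ≤ p i) (hpB : ∀ i, IsCoprime (p i : ℤ) B) (C₀ : ℝ) :
    ∀ᶠ n in atTop, ∀ z : ι → ℕ, u n ≠ 0 → ∏ i, (p i : ℤ) ^ z i ∣ u n →
      C₀ * ∏ i, (p i : ℝ) ^ z i < |(u n : ℝ)| := by
  wlog hC₀ : 1 ≤ C₀ generalizing C₀
  · filter_upwards [this (max 1 C₀) (le_max_left _ _)] with n hn z hz hdvd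
    refine lt_of_le_of_lt ?_ (hn z hz hdvd)
    gcongr
    exact le_max_right _ _
  obtain ⟨c, hc1, hcup, hclow⟩ := exists_abs_le_and_le_abs hrec hadd hmul hαβ ha
  obtain ⟨C, hC1, hC⟩ := abs_le_of_dvd_of_dvd hrec hΔ hadd hmul hαβ hβ ha hb
  have hα1 : 1 < |α| := by
    have hB : (1 : ℝ) ≤ |(B : ℝ)| := by
      have hB0 : B ≠ 0 := by
        rintro rfl
        have hα0 : α ≠ 0 := abs_pos.mp ((abs_nonneg β).trans_lt hαβ)
        exact mul_ne_zero hα0 hβ (by simpa using hmul)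
      exact_mod_cast Int.one_le_abs hB0
    rw [← abs_neg, ← hmul, abs_mul] at hB
    nlinarith [abs_nonneg β, abs_nonneg α]
  have hα0 : 0 < |α| := one_pos.trans hα1
  set l := Real.log |α| with hl
  have hl0 : 0 < l := Real.log_pos hα1
  set q : ℝ := ∏ i, (p i : ℝ) with hq
  have hp1 : ∀ i, (1 : ℝ) ≤ p i := fun i => by exact_mod_cast one_le_two.trans (hp i)
  have hq1 : 1 ≤ q := Finset.one_le_prod fun i _ => hp1 i
  obtain ⟨κ, hκ⟩ := pow_unbounded_of_one_lt (c * |α|) one_lt_two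
  obtain ⟨K, hK⟩ := exists_nat_gt (16 * Real.log q / l)
  have hlogq : 0 ≤ Real.log q := Real.log_nonneg hq1
  have hK0 : 0 < K := by
    have : (0 : ℝ) < K := lt_of_le_of_lt (by positivity) hK
    exact_mod_cast this
  rw [div_lt_iff₀ hl0] at hK
  by_contra hcon
  set T : ℕ → (ι → ℕ) → Prop := fun n z => u n ≠ 0 ∧ ∏ i, (p i : ℤ) ^ z i ∣ u n ∧
    |(u n : ℝ)| ≤ C₀ * ∏ i, (p i : ℝ) ^ z i
  have hT : ∃ᶠ n in atTop, ∃ z, T n z := by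
    refine fun h => hcon ?_
    filter_upwards [h] with n hn z h1 h2
    by_contra h3
    exact hn ⟨z, h1, h2, not_lt.mp h3⟩
  have hκ' : ∀ n z, 0 < n → T n z → ∀ i, z i ≤ κ * n := by
    rintro n z hn ⟨h0, hdvd, -⟩ i
    have h1 : (p i : ℤ) ^ z i ∣ u n :=
      (Finset.dvd_prod_of_mem (fun i => (p i : ℤ) ^ z i) (Finset.mem_univ i)).trans hdvd
    have h2 : (p i : ℤ) ^ z i ≤ |u n| := Int.le_of_dvd (abs_pos.mpr h0) ((dvd_abs _ _).mpr h1)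
    have h3 : ((p i : ℝ)) ^ z i ≤ |(u n : ℝ)| := by exact_mod_cast h2
    have h4 : (2 : ℝ) ^ z i ≤ 2 ^ (κ * n) := by
      calc (2 : ℝ) ^ z i ≤ (p i : ℝ) ^ z i := by
            gcongr
            exact_mod_cast hp i
        _ ≤ c * |α| ^ n := h3.trans (hcup n)
        _ ≤ c ^ n * |α| ^ n := by
            gcongr
            exact le_self_pow₀ hc1 hn.ne'
        _ = (c * |α|) ^ n := (mul_pow _ _ _).symm
        _ ≤ (2 ^ κ) ^ n := by gcongr
        _ = 2 ^ (κ * n) := (pow_mul _ _ _).symm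
    exact (pow_le_pow_iff_right₀ one_lt_two).mp h4
  obtain ⟨v, hv⟩ := exists_frequently_div_eq κ K hT hκ'
  set c₇ : ℝ := Real.log (c * C₀) + Real.log C with hc₇
  have hcC : 1 ≤ c * C₀ := one_le_mul_of_one_le_of_one_le hc1 hC₀
  have hlogC : 0 ≤ Real.log C := Real.log_nonneg hC1
  have hlogc : 0 ≤ Real.log (c * C₀) := Real.log_nonneg hcC
  have hlarge : ∀ᶠ n : ℕ in atTop, 8 * (c₇ + K * l) < n * l :=
    (tendsto_natCast_atTop_atTop.atTop_mul_const hl0).eventually_gt_atTop _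
  obtain ⟨n₁, ⟨z₁, ⟨hu₁, hdvd₁, hle₁⟩, hz₁⟩, hlow, hlarge, hn₁⟩ :=
    (hv.and_eventually (hclow.and (hlarge.and (eventually_gt_atTop 0)))).exists
  obtain ⟨n₂, ⟨z₂, ⟨-, hdvd₂, -⟩, hz₂⟩, h40⟩ :=
    (hv.and_eventually (eventually_ge_atTop (40 * n₁))).exists
  refine hlarge.not_ge (mul_le_of_log_le hl0 hK0 hlogq hK.le hn₁ h40 ?_)
  have hL : 40 ≤ n₂ / n₁ := (Nat.le_div_iff_mul_le hn₁).mpr h40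
  have hLn : n₂ / n₁ * n₁ ≤ n₂ := Nat.div_mul_le_self _ _
  have hdm : n₂ / n₁ * n₁ + n₂ % n₁ = n₂ := Nat.div_add_mod' n₂ n₁
  set e := n₂ % n₁
  set L := n₂ / n₁
  set d := L / 4 with hd
  set S := n₂ / K + 1 with hS
  set M := 2 * d + 1 with hM
  have hML : M ≤ L := by omega
  set m : ι → ℕ := fun i => M * z₁ i - S with hm
  have hcmp : ∀ i, m i ≤ z₂ i := fun i => by
    have := le_add_of_div_eq hK0 hn₁ ((hz₁ i).trans (hz₂ i).symm) hLn hML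
    simp only [hm]
    omega
  have hdvd₁' : ∏ i, (p i : ℤ) ^ m i ∣ u n₁ ^ M := by
    refine Dvd.dvd.trans ?_ (pow_dvd_pow_of_dvd hdvd₁ M)
    rw [← Finset.prod_pow]
    refine Finset.prod_dvd_prod_of_dvd _ _ fun i _ => ?_
    rw [← pow_mul]
    refine pow_dvd_pow _ ?_
    rw [mul_comm (z₁ i)]
    exact Nat.sub_le _ _
  have hdvd₂' : ∏ i, (p i : ℤ) ^ m i ∣ u ((L - 2 - d + 2 + d) * n₁ + e) := by
    rw [show L - 2 - d + 2 + d = L by omega, hdm]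
    exact (Finset.prod_dvd_prod_of_dvd _ _ fun i _ => pow_dvd_pow _ (hcmp i)).trans hdvd₂
  have key := hC (L - 2 - d) d e n₁ _
    (IsCoprime.prod_left fun i _ => (hpB i).pow_left) hu₁ hdvd₁' hdvd₂'
  rw [show L - 2 - d + 2 + d = L by omega] at key
  have hprod : (∏ i, (p i : ℝ) ^ z₁ i) ^ M ≤ (∏ i, (p i : ℝ) ^ m i) * q ^ S := by
    rw [hq, ← Finset.prod_pow, ← Finset.prod_pow, ← Finset.prod_mul_distrib]
    refine Finset.prod_le_prod (fun i _ => by positivity) fun i _ => ?_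
    rw [← pow_mul, ← pow_add]
    refine pow_le_pow_right₀ (hp1 i) ?_
    rw [mul_comm (z₁ i)]
    exact le_tsub_add
  have hm' : ∏ i, (p i : ℝ) ^ m i ≤ C ^ L * |α| ^ (e + (d + 1) * n₁) := by
    refine le_trans (le_of_eq ?_) key
    push_cast
    exact (abs_of_nonneg (by positivity)).symm
  have hfin : |α| ^ (n₁ * M) ≤
      (c * C₀) ^ L * ((C ^ L * |α| ^ (e + (d + 1) * n₁)) * q ^ S) := by
    calc |α| ^ (n₁ * M) = (|α| ^ n₁) ^ M := pow_mul _ _ _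
      _ ≤ (c * (C₀ * ∏ i, (p i : ℝ) ^ z₁ i)) ^ M := by
          gcongr
          exact hlow.trans (by gcongr)
      _ = (c * C₀) ^ M * (∏ i, (p i : ℝ) ^ z₁ i) ^ M := by rw [← mul_assoc, mul_pow]
      _ ≤ (c * C₀) ^ L * ((∏ i, (p i : ℝ) ^ m i) * q ^ S) := by
          gcongr
      _ ≤ _ := by gcongr
  have hcC0 : 0 < c * C₀ := one_pos.trans_le hcC
  have hC0 : 0 < C := one_pos.trans_le hC1
  have hq0 : 0 < q := one_pos.trans_le hq1
  have hlog := Real.log_le_log (by positivity) hfin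
  rw [Real.log_mul (by positivity) (by positivity), Real.log_mul (by positivity) (by positivity),
    Real.log_mul (by positivity) (by positivity), Real.log_pow, Real.log_pow, Real.log_pow,
    Real.log_pow, Real.log_pow, ← hl] at hlog
  push_cast at hlog ⊢
  linarith

theorem sq_sub_eq_neg_pow_mul_recNorm {A B : ℤ} {u : ℕ → ℤ}
    (hrec : ∀ n, u (n + 2) = A * u (n + 1) + B * u n) (n : ℕ) :
    u (n + 1) ^ 2 - A * u (n + 1) * u n - B * u n ^ 2 = (-B) ^ n * recNorm A B u := by
  induction n with
  | zero => simp [recNorm]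
  | succ n ih =>
    rw [hrec]
    linear_combination (-B) * ih

/-- The powers of a prime dividing `B` but not `A` which divide `u n` are bounded. -/
theorem exists_lt_of_pow_dvd {A B : ℤ} {u : ℕ → ℤ}
    (hrec : ∀ n, u (n + 2) = A * u (n + 1) + B * u n) (hN : recNorm A B u ≠ 0)
    {p : ℕ} (hp : p.Prime) (hpB : (p : ℤ) ∣ B) (hpA : ¬ (p : ℤ) ∣ A) :
    ∃ K : ℕ, ∀ n z : ℕ, K ≤ n → (p : ℤ) ^ z ∣ u n → z < K := by
  have hp' : Prime (p : ℤ) := Nat.prime_iff_prime_int.mp hp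
  have hV : ∀ n, ∃ V W : ℤ, ¬ (p : ℤ) ∣ V ∧ ¬ (p : ℤ) ∣ W ∧
      (2 * u 1 - A * u 0) * u (n + 2) - (A * u 1 + 2 * B * u 0) * u (n + 1) =
        recNorm A B u * V ∧
      (2 * u 1 - A * u 0) * u (n + 3) - (A * u 1 + 2 * B * u 0) * u (n + 2) =
        recNorm A B u * W := by
    have hstep : ∀ V W : ℤ, ¬ (p : ℤ) ∣ W → ¬ (p : ℤ) ∣ A * W + B * V := fun V W hW h =>
      (hp'.dvd_or_dvd ((dvd_add_left (hpB.mul_right V)).mp h)).elim hpA hW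
    intro n
    induction n with
    | zero =>
      refine ⟨A, A * A + B * 2, hpA, hstep 2 A hpA, ?_, ?_⟩
      · rw [zero_add, hrec 0, zero_add, recNorm]
        ring
      · rw [hrec 1, zero_add, hrec 0, zero_add, recNorm]
        ring
    | succ n ih =>
      obtain ⟨V, W, hV, hW, h1, h2⟩ := ih
      refine ⟨W, A * W + B * V, hW, hstep V W hW, h2, ?_⟩
      rw [hrec (n + 2)]
      linear_combination A * h2 + B * h1 - (A * u 1 + 2 * B * u 0) * hrec (n + 1)
  set k := (recNorm A B u).natAbs with hk
  have hpk : ¬ (p : ℤ) ^ k ∣ recNorm A B u := by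
    intro h
    have h1 : p ^ k ∣ k := by simpa [Int.natAbs_pow] using Int.natAbs_dvd_natAbs.mpr h
    have h2 := Nat.le_of_dvd (Int.natAbs_pos.mpr hN) h1
    exact absurd (Nat.lt_pow_self hp.one_lt) (not_lt.mpr h2)
  refine ⟨2 * k + 1, fun n z hn hz => ?_⟩
  by_contra! hcon
  have h2k : ((p : ℤ) ^ k) ^ 2 ∣ u n := by
    rw [← pow_mul]
    exact (pow_dvd_pow _ (by omega)).trans hz
  have hB2k : ((p : ℤ) ^ k) ^ 2 ∣ (-B) ^ n := by
    rw [← pow_mul]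
    exact (pow_dvd_pow _ (by omega)).trans (pow_dvd_pow_of_dvd (hpB.neg_right) n)
  have hk1 : (p : ℤ) ^ k ∣ u n := (dvd_pow_self _ two_ne_zero).trans h2k
  have hk2 : (p : ℤ) ^ k ∣ u (n + 1) := by
    rw [← Int.pow_dvd_pow_iff two_ne_zero]
    have h := sq_sub_eq_neg_pow_mul_recNorm hrec n
    rw [show u (n + 1) ^ 2 = (-B) ^ n * recNorm A B u + u n * (A * u (n + 1) + B * u n) by
      linear_combination h]
    exact dvd_add (hB2k.mul_right _) (h2k.mul_right _)
  obtain ⟨j, rfl⟩ : ∃ j, n = j + 1 := ⟨n - 1, by omega⟩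
  obtain ⟨V, -, hVp, -, hVeq, -⟩ := hV j
  have h3 : (p : ℤ) ^ k ∣ recNorm A B u * V := by
    rw [← hVeq]
    exact dvd_sub (hk2.mul_left _) (hk1.mul_left _)
  exact hpk (hp'.pow_dvd_of_dvd_mul_right k hVp h3)

/-- Proposition 2, Pethő–de Weger: effective finiteness for
`u_n = w·p₁^{z₁}⋯p_s^{z_s}`. -/
theorem stmt_9 (A B : ℤ) (hA : A ≠ 0) (hB : B ≠ 0)
    (hΔ : (0:ℤ) < A ^ 2 + 4 * B)
    (α β : ℝ)
    (hαroot : α ^ 2 = A * α + B) (hβroot : β ^ 2 = A * β + B)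
    (hαβ : |β| < |α|)
    (u₀ u₁ : ℤ) (hu01 : u₀ ≠ 0 ∨ u₁ ≠ 0)
    (u : ℕ → ℤ)
    (hrec : ∀ n, u (n + 2) = A * u (n + 1) + B * u n)
    (a b : ℝ) (ha : a = (u₁ : ℝ) - u₀ * β) (hb : b = (u₁ : ℝ) - u₀ * α)
    (hbinet : ∀ n : ℕ, (u n : ℝ) = (a * α ^ n - b * β ^ n) / (α - β))
    (hnd : a * b * α * β ≠ 0)
    (s : ℕ) (hs : 1 ≤ s)
    (p : Fin s → ℕ) (hp : ∀ i, (p i).Prime) (hpinj : Function.Injective p)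
    (w : ℤ) (hw : w ≠ 0) (hpw : ∀ i, ¬ ((p i : ℤ) ∣ w))
    (hpAB : ∀ i, ¬ (p i ∣ Int.gcd A B)) :
    ∃ C : ℝ, ∀ n : ℕ, ∀ z : Fin s → ℕ,
      u n = w * ∏ i, (p i : ℤ) ^ (z i) →
      (n : ℝ) < C ∧ ∀ i, (z i : ℝ) < C := by
  classical
  have hβ0 : β ≠ 0 := right_ne_zero_of_mul hnd
  have ha0 : a ≠ 0 := fun h => hnd (by simp [h])
  have hb0 : b ≠ 0 := fun h => hnd (by simp [h])
  have hne : α - β ≠ 0 := by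
    rw [sub_ne_zero]
    rintro rfl
    exact lt_irrefl _ hαβ
  have hadd : α + β = A := mul_left_cancel₀ hne (by linear_combination hαroot - hβroot)
  have hmul : α * β = -B := by linear_combination α * hadd - hαroot
  have hu0 : u 0 = u₀ := by
    have h := hbinet 0
    rw [eq_div_iff hne, ha, hb] at h
    exact_mod_cast mul_right_cancel₀ hne (h.trans (by ring) : (u 0 : ℝ) * (α - β) = u₀ * (α - β))
  have hu1 : u 1 = u₁ := by
    have h := hbinet 1
    rw [eq_div_iff hne, ha, hb] at h
    exact_mod_cast mul_right_cancel₀ hne (h.trans (by ring) : (u 1 : ℝ) * (α - β) = u₁ * (α - β))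
  rw [← hu0, ← hu1] at ha hb
  rw [ha] at ha0
  rw [hb] at hb0
  have hN : recNorm A B u ≠ 0 := by
    intro h
    have h1 := mul_eq_recNorm u hadd hmul
    rw [h, Int.cast_zero] at h1
    exact mul_ne_zero ha0 hb0 h1
  have hp2 : ∀ i, (2 : ℝ) ≤ p i := fun i => by exact_mod_cast (hp i).two_le
  have hbad : ∀ i, ∃ K : ℕ, (p i : ℤ) ∣ B → ∀ n z : ℕ, K ≤ n → (p i : ℤ) ^ z ∣ u n → z < K := by
    intro i
    by_cases h : (p i : ℤ) ∣ B
    · have hpA : ¬ (p i : ℤ) ∣ A := fun hA' =>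
        hpAB i (Int.natCast_dvd_natCast.mp (Int.dvd_coe_gcd hA' h))
      obtain ⟨K, hK⟩ := exists_lt_of_pow_dvd hrec hN (hp i) h hpA
      exact ⟨K, fun _ => hK⟩
    · exact ⟨0, fun h' => absurd h' h⟩
  choose K hK using hbad
  have hcore := eventually_forall_prod_pow_dvd_imp_lt hrec hΔ hadd hmul hαβ hβ0 ha0 hb0
    (p := fun i : {i // ¬ (p i : ℤ) ∣ B} => p i) (fun i => (hp i).two_le)
    (fun i => ((Nat.prime_iff_prime_int.mp (hp i)).coprime_iff_not_dvd).mpr i.2)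
    (|(w : ℝ)| * ∏ i : {i // (p i : ℤ) ∣ B}, (p i : ℝ) ^ K i)
  obtain ⟨N, hN⟩ := Filter.eventually_atTop.mp
    (hcore.and (Filter.eventually_all.mpr fun i => Filter.eventually_ge_atTop (K i)))
  have hu : ∀ n (z : Fin s → ℕ), u n = w * ∏ i, (p i : ℤ) ^ z i → u n ≠ 0 := fun n z h => by
    rw [h]
    exact mul_ne_zero hw (Finset.prod_ne_zero_iff.mpr fun i _ =>
      pow_ne_zero _ (by exact_mod_cast (hp i).ne_zero))
  have hnN : ∀ n (z : Fin s → ℕ), u n = w * ∏ i, (p i : ℤ) ^ z i → n < N := by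
    intro n z h
    by_contra! hn
    obtain ⟨h1, h2⟩ := hN n hn
    have hdvd : ∀ i, (p i : ℤ) ^ z i ∣ u n := fun i => by
      rw [h]
      exact (Finset.dvd_prod_of_mem (fun i => (p i : ℤ) ^ z i) (Finset.mem_univ i)).mul_left w
    refine (h1 (fun i => z i) (hu n z h) ?_).not_ge ?_
    · rw [h, ← Fintype.prod_subtype_mul_prod_subtype (fun i => (p i : ℤ) ∣ B)]
      exact (Dvd.intro_left _ rfl).mul_left w
    · rw [h]
      push_cast
      rw [abs_mul, abs_of_nonneg (by positivity : (0 : ℝ) ≤ ∏ i, (p i : ℝ) ^ z i),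
        ← Fintype.prod_subtype_mul_prod_subtype (fun i => (p i : ℤ) ∣ B), ← mul_assoc]
      gcongr with i
      · exact one_le_two.trans (hp2 i)
      · exact (hK i i.2 n (z i) (h2 i) (hdvd i)).le
  refine ⟨max N (∑ k ∈ Finset.range N, |(u k : ℝ)|), fun n z h => ⟨?_, fun i => ?_⟩⟩
  · exact lt_max_of_lt_left (by exact_mod_cast hnN n z h)
  · refine lt_max_of_lt_right ?_
    have hle : (p i : ℤ) ^ z i ≤ |u n| := by
      refine Int.le_of_dvd (abs_pos.mpr (hu n z h)) ((dvd_abs _ _).mpr ?_)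
      rw [h]
      exact (Finset.dvd_prod_of_mem (fun i => (p i : ℤ) ^ z i) (Finset.mem_univ i)).mul_left w
    calc (z i : ℝ) < (p i : ℝ) ^ z i := by exact_mod_cast Nat.lt_pow_self (hp i).one_lt
      _ ≤ |(u n : ℝ)| := by exact_mod_cast hle
      _ ≤ _ := Finset.single_le_sum (f := fun k => |(u k : ℝ)|) (fun k _ => abs_nonneg _)
          (Finset.mem_range.mpr (hnN n z h))
end

section
/- Assume the sequence u is non-degenerate, that p_i does not divide gcd(A,B) for any 1 ≤ i ≤ s, and that there is no nonnegative integer m with β ∈ {1, −1} and a·α^m = 2·b·β^m. Then there exists a real constant c₁₈ (depending only on A, B, u₀, u₁, w, s and p₁, …, p_s) such that every tuple (n, m, z₁, …, z_s) of nonnegative integers with n > m, u_n + u_m = w·p₁^{z₁}⋯p_s^{z_s} and b·β^n − a·α^m + b·β^m = 0 satisfies n < c₁₈. -/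
theorem Int.lt_natAbs_of_pow_dvd {q x : ℤ} (hq : 2 ≤ q.natAbs) (hx : x ≠ 0) {n : ℕ}
    (h : q ^ n ∣ x) : n < x.natAbs := by
  have h1 := Nat.le_of_dvd (Int.natAbs_pos.2 hx) (Int.natAbs_dvd_natAbs.2 h)
  rw [Int.natAbs_pow] at h1
  exact (Nat.lt_two_pow_self.trans_le (Nat.pow_le_pow_left hq n)).trans_le h1

/-- Conjugation `α ↔ β` applied to an integer relation satisfied by an irrational root `α`. -/
theorem conj_relation {A B : ℤ} {α β : ℝ} (hsum : α + β = A) (hprod : α * β = -B)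
    (hα : α ^ 2 = A * α + B) (hβ : β ^ 2 = A * β + B) (hirr : Irrational α)
    (u₀ u₁ N : ℤ) (n : ℕ) (h : ((u₁ : ℝ) - u₀ * β) * α ^ n = N * (α - β)) :
    ((u₁ : ℝ) - u₀ * α) * β ^ n = N * (β - α) := by
  have key : ∃ x y : ℤ, α ^ n = x + y * α ∧ β ^ n = x + y * β := by
    clear h
    induction n with
    | zero => exact ⟨1, 0, by simp, by simp⟩
    | succ k ih =>
      obtain ⟨x, y, h1, h2⟩ := ih
      refine ⟨y * B, x + y * A, ?_, ?_⟩
      · rw [pow_succ, h1]; push_cast; linear_combination (y : ℝ) * hα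
      · rw [pow_succ, h2]; push_cast; linear_combination (y : ℝ) * hβ
  obtain ⟨x, y, h1, h2⟩ := key
  rw [h1] at h
  rw [h2]
  have hβ' : β = A - α := by linarith
  have hlin : ((u₁ * x - u₀ * x * A + u₀ * y * B + N * A : ℤ) : ℝ)
      + ((u₀ * x + u₁ * y - 2 * N : ℤ) : ℝ) * α = 0 := by
    push_cast
    linear_combination h + (u₀ * x - N : ℝ) * hsum + (u₀ * y : ℝ) * hprod
  have hQ : u₀ * x + u₁ * y - 2 * N = 0 := by
    by_contra hQ
    exact ((hirr.intCast_mul hQ).intCast_add _).ne_zero hlin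
  rw [hQ] at hlin
  have hP : ((u₁ * x - u₀ * x * A + u₀ * y * B + N * A : ℤ) : ℝ) = 0 := by simpa using hlin
  have hQ' : ((u₀ * x + u₁ * y - 2 * N : ℤ) : ℝ) = 0 := by rw [hQ]; simp
  push_cast at hP hQ'
  linear_combination hP + β * hQ' - (u₀ * y : ℝ) * hprod - (u₀ * x - N : ℝ) * hsum

theorem exists_int_of_root {A B : ℤ} {x : ℝ} (hx : x ^ 2 = A * x + B) (h : ¬ Irrational x) :
    ∃ k : ℤ, (k : ℝ) = x := by
  obtain ⟨q, rfl⟩ : ∃ q : ℚ, (q : ℝ) = x := by simpa [Irrational] using h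
  have hq : q ^ 2 = A * q + B := by exact_mod_cast hx
  have hint : IsIntegral ℤ q := by
    refine ⟨.X ^ 2 - (.C A * .X + .C B), ?_, ?_⟩
    · exact Polynomial.monic_X_pow_sub (Polynomial.degree_linear_le.trans_lt (by norm_num))
    · rw [← Polynomial.aeval_def]
      simp [hq]
  obtain ⟨k, hk⟩ := IsIntegrallyClosed.isIntegral_iff.1 hint
  exact ⟨k, by rw [← hk]; simp⟩

theorem bounded_of_int_roots {α β a b w : ℤ} (hαβ : β.natAbs < α.natAbs) (hβ0 : β ≠ 0)
    (ha : a ≠ 0) (hb : b ≠ 0) (hw : w ≠ 0)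
    {s : ℕ} {p : Fin s → ℕ} (hp : ∀ i, (p i).Prime)
    (hpc : ∀ i, ¬ ((p i : ℤ) ∣ α ∧ (p i : ℤ) ∣ β))
    (hE : ¬ ∃ m : ℕ, (β = 1 ∨ β = -1) ∧ a * α ^ m = 2 * b * β ^ m) :
    ∃ c : ℕ, ∀ n m : ℕ, ∀ z : Fin s → ℕ, m < n →
      a * α ^ n = (α - β) * (w * ∏ i, (p i : ℤ) ^ (z i)) →
      b * β ^ n - a * α ^ m + b * β ^ m = 0 → n < c := by
  have hα0 : α ≠ 0 := by rintro rfl; simp at hαβ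
  have hsub : (α - β) * w ≠ 0 := mul_ne_zero (sub_ne_zero.2 (by rintro rfl; simp at hαβ)) hw
  by_cases hcop : IsCoprime α β
  · by_cases h1 : β = 1 ∨ β = -1
    · refine ⟨0, fun n m z hmn _ h => (hE ⟨m, h1, ?_⟩).elim⟩
      obtain ⟨k, rfl⟩ := Nat.exists_eq_add_of_lt hmn
      have hk : β ^ (k + 1) = 1 ∨ β ^ (k + 1) = -1 := by
        rcases h1 with rfl | rfl
        · simp
        · exact neg_one_pow_eq_or ℤ _
      rw [add_assoc, pow_add] at h
      rcases hk with hk | hk <;> rw [hk] at h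
      · linear_combination -h
      · exact (mul_ne_zero ha (pow_ne_zero m hα0) (by linear_combination -h)).elim
    · have hβ2 : 2 ≤ β.natAbs := by omega
      refine ⟨a.natAbs * α.natAbs ^ a.natAbs + b.natAbs * α.natAbs ^ a.natAbs + 1,
        fun n m z hmn _ h => ?_⟩
      have hm : m < a.natAbs := by
        refine Int.lt_natAbs_of_pow_dvd hβ2 ha ?_
        refine (hcop.symm.pow (m := m) (n := m)).dvd_of_dvd_mul_right ?_
        rw [show a * α ^ m = b * β ^ n + b * β ^ m by linear_combination -h]
        exact dvd_add (dvd_mul_of_dvd_right (pow_dvd_pow _ hmn.le) _) (dvd_mul_left _ _)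
      have hle : (b * β ^ n).natAbs ≤ (a * α ^ m).natAbs + (b * β ^ m).natAbs := by
        rw [show b * β ^ n = a * α ^ m - b * β ^ m by linear_combination h]
        exact Int.natAbs_sub_le _ _
      have hn := Int.lt_natAbs_of_pow_dvd hβ2 (mul_ne_zero hb (pow_ne_zero n hβ0))
        (dvd_mul_left (β ^ n) b)
      simp only [Int.natAbs_mul, Int.natAbs_pow] at hle hn
      have hpow : α.natAbs ^ m ≤ α.natAbs ^ a.natAbs :=
        Nat.pow_le_pow_right (by omega) hm.le
      have hpow' : β.natAbs ^ m ≤ α.natAbs ^ a.natAbs :=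
        (Nat.pow_le_pow_left hαβ.le m).trans hpow
      have := Nat.mul_le_mul_left a.natAbs hpow
      have := Nat.mul_le_mul_left b.natAbs hpow'
      omega
  · obtain ⟨q, hq, hqα, hqβ⟩ : ∃ q : ℕ, q.Prime ∧ (q : ℤ) ∣ α ∧ (q : ℤ) ∣ β := by
      rw [Int.isCoprime_iff_gcd_eq_one] at hcop
      obtain ⟨q, hq, hd⟩ := Nat.exists_prime_and_dvd hcop
      exact ⟨q, hq, (Int.natCast_dvd_natCast.2 hd).trans (Int.gcd_dvd_left _ _),
        (Int.natCast_dvd_natCast.2 hd).trans (Int.gcd_dvd_right _ _)⟩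
    refine ⟨((α - β) * w).natAbs, fun n m z _ h _ => ?_⟩
    refine Int.lt_natAbs_of_pow_dvd (q := q) (by simpa using hq.two_le) hsub ?_
    have hc : IsCoprime ((q : ℤ) ^ n) (∏ i, (p i : ℤ) ^ (z i)) := by
      refine IsCoprime.prod_right fun i _ => IsCoprime.pow ?_
      rw [Nat.isCoprime_iff_coprime, Nat.coprime_primes hq (hp i)]
      rintro rfl
      exact hpc i ⟨hqα, hqβ⟩
    refine hc.dvd_of_dvd_mul_right ?_
    rw [mul_assoc, ← h]
    exact dvd_mul_of_dvd_right (pow_dvd_pow_of_dvd hqα n) a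

/-- Lemma 4: the degenerate case `Λ = 0`, i.e.
`b·β^n − a·α^m + b·β^m = 0`, forces `n < c₁₈`. -/
theorem stmt_10 (A B : ℤ) (hA : A ≠ 0) (hB : B ≠ 0)
    (hΔ : (0:ℤ) < A ^ 2 + 4 * B)
    (α β : ℝ)
    (hαroot : α ^ 2 = A * α + B) (hβroot : β ^ 2 = A * β + B)
    (hαβ : |β| < |α|)
    (u₀ u₁ : ℤ) (hu01 : u₀ ≠ 0 ∨ u₁ ≠ 0)
    (u : ℕ → ℤ)
    (hrec : ∀ n, u (n + 2) = A * u (n + 1) + B * u n)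
    (a b : ℝ) (ha : a = (u₁ : ℝ) - u₀ * β) (hb : b = (u₁ : ℝ) - u₀ * α)
    (hbinet : ∀ n : ℕ, (u n : ℝ) = (a * α ^ n - b * β ^ n) / (α - β))
    (hnd : a * b * α * β ≠ 0)
    (s : ℕ) (hs : 1 ≤ s)
    (p : Fin s → ℕ) (hp : ∀ i, (p i).Prime) (hpinj : Function.Injective p)
    (w : ℤ) (hw : w ≠ 0) (hpw : ∀ i, ¬ ((p i : ℤ) ∣ w))
    (hpAB : ∀ i, ¬ (p i ∣ Int.gcd A B))
    (hE1 : ¬ ∃ m : ℕ, (β = 1 ∨ β = -1) ∧ a * α ^ m = 2 * b * β ^ m) :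
    ∃ c₁₈ : ℝ, ∀ n m : ℕ, ∀ z : Fin s → ℕ, m < n →
      u n + u m = w * ∏ i, (p i : ℤ) ^ (z i) →
      b * β ^ n - a * α ^ m + b * β ^ m = 0 →
      (n : ℝ) < c₁₈ := by
  have ha0 : a ≠ 0 := by rintro rfl; simp at hnd
  have hb0 : b ≠ 0 := by rintro rfl; simp at hnd
  have hβ0 : β ≠ 0 := by rintro rfl; simp at hnd
  have hne : α - β ≠ 0 := sub_ne_zero.2 (by rintro rfl; exact lt_irrefl _ hαβ)
  have hsum : α + β = A := mul_left_cancel₀ hne (by linear_combination hαroot - hβroot)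
  have hprod : α * β = -B := by linear_combination α * hsum - hαroot
  have hN : ∀ n m : ℕ, b * β ^ n - a * α ^ m + b * β ^ m = 0 →
      a * α ^ n = ((u n + u m : ℤ) : ℝ) * (α - β) := by
    intro n m h
    push_cast
    rw [hbinet, hbinet]
    field_simp
    linear_combination h
  by_cases hirr : Irrational α
  · have hr : 1 < |α| / |β| := (one_lt_div (abs_pos.2 hβ0)).2 hαβ
    obtain ⟨k, hk⟩ := pow_unbounded_of_one_lt (|b| / |a|) hr
    refine ⟨k, fun n m z _ _ h => ?_⟩
    have h1 := hN n m h
    have h2 : b * β ^ n = ((u n + u m : ℤ) : ℝ) * (β - α) := by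
      rw [ha] at h1
      rw [hb]
      exact conj_relation hsum hprod hαroot hβroot hirr u₀ u₁ _ n h1
    have h3 : |a| * |α| ^ n = |b| * |β| ^ n := by
      rw [← abs_pow, ← abs_pow, ← abs_mul, ← abs_mul, h1, h2, abs_mul, abs_mul, abs_sub_comm]
    have h4 : (|α| / |β|) ^ n = |b| / |a| := by
      have := abs_pos.2 hβ0
      have := abs_pos.2 ha0
      rw [div_pow, div_eq_div_iff (by positivity) (by positivity)]
      linear_combination h3
    rw [← h4] at hk
    exact_mod_cast (pow_lt_pow_iff_right₀ hr).1 hk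
  · obtain ⟨α, rfl⟩ := exists_int_of_root hαroot hirr
    obtain ⟨β, rfl⟩ : ∃ k : ℤ, (k : ℝ) = β := ⟨A - α, by push_cast; linarith⟩
    obtain ⟨a, rfl⟩ : ∃ k : ℤ, (k : ℝ) = a := ⟨u₁ - u₀ * β, by rw [ha]; push_cast; rfl⟩
    obtain ⟨b, rfl⟩ : ∃ k : ℤ, (k : ℝ) = b := ⟨u₁ - u₀ * α, by rw [hb]; push_cast; rfl⟩
    norm_cast at hαβ hsum hprod ha0 hb0 hβ0
    obtain ⟨c, hc⟩ := bounded_of_int_roots (by rw [Int.abs_eq_natAbs, Int.abs_eq_natAbs] at hαβ; exact_mod_cast hαβ) hβ0 ha0 hb0 hw hp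
      (fun i ⟨h1, h2⟩ => hpAB i <| Int.natCast_dvd_natCast.1 <| Int.dvd_coe_gcd
        (hsum ▸ dvd_add h1 h2) ((dvd_neg).1 (hprod ▸ dvd_mul_of_dvd_left h1 β)))
      (fun ⟨m, h1, h2⟩ => hE1 ⟨m, by exact_mod_cast h1, by exact_mod_cast h2⟩)
    refine ⟨c, fun n m z hmn h1 h2 => ?_⟩
    have h3 := hN n m h2
    rw [h1] at h3
    have h4 : a * α ^ n = (w * ∏ i, (p i : ℤ) ^ z i) * (α - β) := by exact_mod_cast h3
    exact_mod_cast hc n m z hmn (by rw [h4, mul_comm]) (by exact_mod_cast h2)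
end

section
/- Assume the sequence u is non-degenerate, and define c₁₇ = log(2·(1 + 2|b|/|a|)) / log(min{|α|/|β|, |α|}). If n > m ≥ 0 and z₁, …, z_s are nonnegative integers with n − m > c₁₇ and u_n + u_m = w·p₁^{z₁}⋯p_s^{z_s}, then |z₁·log p₁ + ⋯ + z_s·log p_s + log(|w|·√Δ/|a|) − n·log|α|| ≤ 2·(1 + 2|b|/|a|)·min{|α|/|β|, |α|}^{−(n−m)}. -/
/-- Comparison of `log (1 + x)` with `x` near `0`. -/
theorem abs_log_one_add_le_two_mul_abs {x : ℝ} (hx : |x| ≤ 1 / 2) :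
    |Real.log (1 + x)| ≤ 2 * |x| := by
  obtain ⟨hl, hu⟩ := abs_le.mp hx
  have hpos : 0 < 1 + x := by linarith
  rw [abs_le]
  constructor
  · have h := Real.one_sub_inv_le_log_of_pos hpos
    have hinv : 1 - (1 + x)⁻¹ = x / (1 + x) := by field_simp; ring
    have hdiv : -(2 * |x|) ≤ x / (1 + x) := by
      rw [le_div_iff₀ hpos]
      nlinarith [neg_abs_le x, abs_nonneg x]
    linarith
  · have h := Real.log_le_sub_one_of_pos hpos
    linarith [le_abs_self x, abs_nonneg x]

/-- The relative error made when the sum of two Binet-type terms is replaced by its dominant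
summand `a * α ^ n`. -/
theorem abs_binet_error_le {a b α β : ℝ} (hα : 1 < |α|) (hβ : β ≠ 0) (hαβ : |β| < |α|)
    {n m : ℕ} (hnm : m ≤ n) :
    |(a * α ^ m - b * β ^ n - b * β ^ m) / (a * α ^ n)|
      ≤ (1 + 2 * |b| / |a|) / (min (|α| / |β|) |α|) ^ (n - m) := by
  rcases eq_or_ne a 0 with rfl | ha
  · simp only [zero_mul, div_zero, abs_zero, add_zero]
    positivity
  obtain ⟨k, rfl⟩ := Nat.exists_eq_add_of_le hnm
  rw [Nat.add_sub_cancel_left]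
  have hα0 : 0 < |α| := by linarith
  have hβ0 : 0 < |β| := abs_pos.mpr hβ
  have ha0 : 0 < |a| := abs_pos.mpr ha
  set M := min (|α| / |β|) |α|
  have hM0 : 0 < M := lt_min (by positivity) hα0
  have hMα : M ^ k ≤ |α| ^ k := pow_le_pow_left₀ hM0.le (min_le_right _ _) k
  have hMβ : M ^ k * |β| ^ k ≤ |α| ^ k := by
    rw [← mul_pow]
    exact pow_le_pow_left₀ (by positivity) ((le_div_iff₀ hβ0).mp (min_le_left _ _)) k
  have hm : |β| ^ m ≤ |α| ^ m := pow_le_pow_left₀ hβ0.le hαβ.le m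
  have hnum : |a * α ^ m - b * β ^ (m + k) - b * β ^ m|
      ≤ |a| * |α| ^ m + |b| * |β| ^ (m + k) + |b| * |β| ^ m := by
    refine (abs_sub _ _).trans (add_le_add ((abs_sub _ _).trans ?_) ?_) <;>
      simp only [abs_mul, abs_pow, le_refl]
  rw [abs_div, abs_mul, abs_pow, div_le_div_iff₀ (by positivity) (by positivity)]
  have h₁ : |β| ^ (m + k) * M ^ k ≤ |α| ^ (m + k) := by
    rw [pow_add, pow_add, mul_assoc, mul_comm (|β| ^ k)]
    exact mul_le_mul hm hMβ (by positivity) (by positivity)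
  have h₂ : |β| ^ m * M ^ k ≤ |α| ^ (m + k) := by
    rw [pow_add]
    exact mul_le_mul hm hMα (by positivity) (by positivity)
  have h₃ : |α| ^ m * M ^ k ≤ |α| ^ (m + k) := by
    rw [pow_add]
    exact mul_le_mul_of_nonneg_left hMα (by positivity)
  calc |a * α ^ m - b * β ^ (m + k) - b * β ^ m| * M ^ k
      ≤ (|a| * |α| ^ m + |b| * |β| ^ (m + k) + |b| * |β| ^ m) * M ^ k := by gcongr
    _ = |a| * (|α| ^ m * M ^ k) + |b| * (|β| ^ (m + k) * M ^ k)
          + |b| * (|β| ^ m * M ^ k) := by ring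
    _ ≤ |a| * |α| ^ (m + k) + |b| * |α| ^ (m + k) + |b| * |α| ^ (m + k) := by gcongr
    _ = (1 + 2 * |b| / |a|) * (|a| * |α| ^ (m + k)) := by field_simp; ring


/-- the key linear form inequality (inequality (14) of the paper):
for `n − m > c₁₇`,
`|z₁ log p₁ + ⋯ + z_s log p_s + log(|w|√Δ/|a|) − n log|α|| ≤
  2(1 + 2|b|/|a|)·min{|α|/|β|, |α|}^{−(n−m)}`. -/
theorem stmt_11 (A B : ℤ) (hA : A ≠ 0) (hB : B ≠ 0)
    (hΔ : (0:ℤ) < A ^ 2 + 4 * B)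
    (α β : ℝ)
    (hαroot : α ^ 2 = A * α + B) (hβroot : β ^ 2 = A * β + B)
    (hαβ : |β| < |α|)
    (u₀ u₁ : ℤ) (hu01 : u₀ ≠ 0 ∨ u₁ ≠ 0)
    (u : ℕ → ℤ)
    (hrec : ∀ n, u (n + 2) = A * u (n + 1) + B * u n)
    (a b : ℝ) (ha : a = (u₁ : ℝ) - u₀ * β) (hb : b = (u₁ : ℝ) - u₀ * α)
    (hbinet : ∀ n : ℕ, (u n : ℝ) = (a * α ^ n - b * β ^ n) / (α - β))
    (hnd : a * b * α * β ≠ 0)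
    (s : ℕ) (hs : 1 ≤ s)
    (p : Fin s → ℕ) (hp : ∀ i, (p i).Prime) (hpinj : Function.Injective p)
    (w : ℤ) (hw : w ≠ 0) (hpw : ∀ i, ¬ ((p i : ℤ) ∣ w))
    (c₁₇ : ℝ)
    (hc₁₇ : c₁₇ = Real.log (2 * (1 + 2 * |b| / |a|)) / Real.log (min (|α| / |β|) |α|))
    (n m : ℕ) (hnm : m < n) (z : Fin s → ℕ)
    (hgap : c₁₇ < (n : ℝ) - (m : ℝ))
    (heq : u n + u m = w * ∏ i, (p i : ℤ) ^ (z i)) :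
    abs ((∑ i, (z i : ℝ) * Real.log (p i))
        + Real.log (|(w : ℝ)| * Real.sqrt ((A : ℝ) ^ 2 + 4 * B) / |a|)
        - (n : ℝ) * Real.log |α|)
      ≤ 2 * (1 + 2 * |b| / |a|) / (min (|α| / |β|) |α|) ^ (n - m) := by
  have hα : α ≠ 0 := by rintro rfl; simp at hnd
  have hβ : β ≠ 0 := by rintro rfl; simp at hnd
  have ha0 : a ≠ 0 := by rintro rfl; simp at hnd
  have hsub : α - β ≠ 0 := by
    intro h
    rw [sub_eq_zero.mp h] at hαβ
    exact lt_irrefl _ hαβ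
  have hsum : α + β = A := by
    apply mul_right_cancel₀ hsub
    linear_combination hαroot - hβroot
  have hprod : α * β = -B := by
    linear_combination α * hsum - hαroot
  have hsqrt : Real.sqrt ((A : ℝ) ^ 2 + 4 * B) = |α - β| := by
    rw [← Real.sqrt_sq_eq_abs]
    congr 1
    linear_combination -(α + β + A) * hsum + 4 * hprod
  have hβpos : 0 < |β| := abs_pos.mpr hβ
  have hα1 : 1 < |α| := by
    have hB1 : (1 : ℝ) ≤ |α| * |β| := by
      rw [← abs_mul, hprod, abs_neg]
      exact_mod_cast Int.one_le_abs hB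
    nlinarith
  have hM1 : 1 < min (|α| / |β|) |α| := lt_min ((one_lt_div hβpos).mpr hαβ) hα1
  have herr := abs_binet_error_le (a := a) (b := b) hα1 hβ hαβ hnm.le
  set M := min (|α| / |β|) |α|
  set K := 1 + 2 * |b| / |a|
  set x := (a * α ^ m - b * β ^ n - b * β ^ m) / (a * α ^ n) with hx
  have hK0 : 0 < K := by positivity
  have hMpow : 0 < M ^ (n - m) := by positivity
  have hKM : 2 * K < M ^ (n - m) := by
    rw [hc₁₇, div_lt_iff₀ (Real.log_pos hM1), ← Nat.cast_sub hnm.le, ← Real.log_pow] at hgap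
    exact (Real.log_lt_log_iff (by positivity) hMpow).mp hgap
  have hhalf : |x| ≤ 1 / 2 := by
    refine herr.trans ?_
    rw [div_le_div_iff₀ hMpow two_pos]
    linarith
  have hp0 : ∀ i, (p i : ℝ) ≠ 0 := fun i => by exact_mod_cast (hp i).ne_zero
  have hw0 : (w : ℝ) ≠ 0 := by exact_mod_cast hw
  have hfactor : (w : ℝ) * (∏ i, (p i : ℝ) ^ z i) * (α - β) / (a * α ^ n) = 1 + x := by
    have h : (u n : ℝ) + u m = w * ∏ i, (p i : ℝ) ^ z i := by exact_mod_cast heq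
    rw [← h, hbinet n, hbinet m, hx]
    field_simp
    ring
  have hlog : (∑ i, (z i : ℝ) * Real.log (p i))
      + Real.log (|(w : ℝ)| * Real.sqrt ((A : ℝ) ^ 2 + 4 * B) / |a|)
      - (n : ℝ) * Real.log |α| = Real.log (1 + x) := by
    have hP : (∏ i, (p i : ℝ) ^ z i) ≠ 0 :=
      Finset.prod_ne_zero_iff.mpr fun i _ => pow_ne_zero _ (hp0 i)
    have hlogP : Real.log (∏ i, (p i : ℝ) ^ z i) = ∑ i, (z i : ℝ) * Real.log (p i) := by
      rw [Real.log_prod fun i _ => pow_ne_zero _ (hp0 i)]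
      simp only [Real.log_pow]
    rw [← hfactor, hsqrt, ← abs_mul, ← abs_div, Real.log_abs, Real.log_abs,
      Real.log_div (mul_ne_zero hw0 hsub) ha0, Real.log_mul hw0 hsub,
      Real.log_div (mul_ne_zero (mul_ne_zero hw0 hP) hsub) (mul_ne_zero ha0 (pow_ne_zero _ hα)),
      Real.log_mul (mul_ne_zero hw0 hP) hsub, Real.log_mul hw0 hP,
      Real.log_mul ha0 (pow_ne_zero _ hα), Real.log_pow, hlogP]
    ring
  rw [hlog, mul_div_assoc]
  exact (abs_log_one_add_le_two_mul_abs hhalf).trans (by gcongr)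
end

section
/- Let k ≥ 2 be an integer, let η₀, η₁, …, η_k be real numbers, let C, c₃, c₄ be positive real numbers and let X₁, …, X_k be nonnegative real numbers. Let 𝓛 ⊆ ℝ^k be the additive subgroup generated by the vectors b⁽ʲ⁾ = e_j + ⌊C·η_j⌉·e_k for 1 ≤ j ≤ k−1 and b⁽ᵏ⁾ = ⌊C·η_k⌉·e_k, and let y = −⌊C·η₀⌉·e_k. Suppose c₁ > 0 is such that ‖x − y‖ ≥ c₁ for every x ∈ 𝓛 with x ≠ y. Put S = X₁² + ⋯ + X_{k−1}² and T = (1 + X₁ + ⋯ + X_k)/2, and assume c₁² > T² + S. Then for all integers x₁, …, x_k with |x_i| ≤ X_i for each 1 ≤ i ≤ k and every real number H with |η₀ + x₁·η₁ + ⋯ + x_k·η_k| ≤ c₃·exp(−c₄·H), either x₁ = ⋯ = x_{k−1} = 0 and x_k·⌊C·η_k⌉ = −⌊C·η₀⌉, or H ≤ (1/c₄)·(log(C·c₃) − log(√(c₁² − S) − T)). -/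
/-- LLL reduction lemma, Lemma 6 of the paper: reduction of upper
bounds via an approximation lattice.  Here `r : ℝ → ℤ` is a fixed nearest-integer
function, `last` is the last index of `Fin k`, the lattice `𝓛` is the additive
subgroup generated by the columns `b j`, and `y` is the target vector. -/
theorem stmt_12 (k : ℕ) (hk : 2 ≤ k)
    (η₀ : ℝ) (η : Fin k → ℝ)
    (C c₁ c₃ c₄ : ℝ) (hC : 0 < C) (hc₁ : 0 < c₁) (hc₃ : 0 < c₃) (hc₄ : 0 < c₄)
    (X : Fin k → ℝ) (hX : ∀ i, 0 ≤ X i)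
    (r : ℝ → ℤ) (hr : ∀ t : ℝ, |t - (r t : ℝ)| ≤ 1 / 2)
    (last : Fin k) (hlast : (last : ℕ) = k - 1)
    (b : Fin k → EuclideanSpace ℝ (Fin k))
    (hb : ∀ j i : Fin k, b j i =
      (if j ≠ last ∧ i = j then (1 : ℝ) else 0) +
      (if i = last then (r (C * η j) : ℝ) else 0))
    (y : EuclideanSpace ℝ (Fin k))
    (hy : ∀ i, y i = if i = last then -(r (C * η₀) : ℝ) else 0)
    (hlat : ∀ x ∈ AddSubgroup.closure (Set.range b), x ≠ y → c₁ ≤ ‖x - y‖)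
    (S T : ℝ)
    (hS : S = ∑ i ∈ Finset.univ.erase last, X i ^ 2)
    (hT : T = (1 + ∑ i, X i) / 2)
    (hgap : T ^ 2 + S < c₁ ^ 2) :
    ∀ x : Fin k → ℤ, (∀ i, |(x i : ℝ)| ≤ X i) →
      ∀ H : ℝ, |η₀ + ∑ i, (x i : ℝ) * η i| ≤ c₃ * Real.exp (-c₄ * H) →
      ((∀ i, i ≠ last → x i = 0) ∧ x last * r (C * η last) = -(r (C * η₀))) ∨
      H ≤ (1 / c₄) * (Real.log (C * c₃) - Real.log (Real.sqrt (c₁ ^ 2 - S) - T)) := by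
  intro x hx H hH
  set v : EuclideanSpace ℝ (Fin k) := ∑ j, x j • b j with hv
  have hvmem : v ∈ AddSubgroup.closure (Set.range b) :=
    sum_mem fun j _ => zsmul_mem (AddSubgroup.subset_closure (Set.mem_range_self j)) _
  have hvi : ∀ i, v i = ∑ j, (x j : ℝ) * b j i := fun i => by
    simp [hv, WithLp.ofLp_sum, Finset.sum_apply]
  have hcoord : ∀ i, i ≠ last → v i = x i := fun i hi => by
    rw [hvi, Finset.sum_eq_single i]
    · simp [hb, hi]
    · intro j _ hj
      simp [hb, hi, hj.symm]
    · simp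
  have hvlast : v last = ∑ j, (x j : ℝ) * (r (C * η j) : ℝ) := by
    rw [hvi]
    refine Finset.sum_congr rfl fun j _ => ?_
    have : ¬ (j ≠ last ∧ last = j) := fun h => h.1 h.2.symm
    rw [hb, if_neg this, if_pos rfl, zero_add]
  by_cases hvy : v = y
  · left
    have hzero : ∀ i, i ≠ last → x i = 0 := fun i hi => by
      have h := hcoord i hi
      rw [hvy, hy, if_neg hi] at h
      exact Int.cast_eq_zero.1 h.symm
    refine ⟨hzero, ?_⟩
    rw [hvy, hy, if_pos rfl, Finset.sum_eq_single last] at hvlast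
    · exact_mod_cast hvlast.symm
    · intro j _ hj
      simp [hzero j hj]
    · simp
  · right
    set Φ : ℝ := ∑ j, (x j : ℝ) * (r (C * η j) : ℝ) + r (C * η₀) with hΦ
    set Λ : ℝ := η₀ + ∑ i, (x i : ℝ) * η i with hΛ
    have hnorm : ‖v - y‖ ^ 2 = ∑ i ∈ Finset.univ.erase last, (x i : ℝ) ^ 2 + Φ ^ 2 := by
      rw [EuclideanSpace.norm_sq_eq, ← Finset.sum_erase_add _ _ (Finset.mem_univ last)]
      congr 1
      · refine Finset.sum_congr rfl fun i hi => ?_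
        have hi' := Finset.ne_of_mem_erase hi
        simp [hcoord i hi', hy, hi']
      · simp [hvlast, hy, hΦ]
    have hsum : ∑ i ∈ Finset.univ.erase last, (x i : ℝ) ^ 2 ≤ S := by
      rw [hS]
      exact Finset.sum_le_sum fun i _ => sq_le_sq' (neg_le_of_abs_le (hx i)) (le_of_abs_le (hx i))
    have hc₁Φ : c₁ ^ 2 - S ≤ Φ ^ 2 := by
      have := pow_le_pow_left₀ hc₁.le (hlat v hvmem hvy) 2
      linarith
    have hsqrt : √(c₁ ^ 2 - S) ≤ |Φ| := by
      rw [← Real.sqrt_sq_eq_abs]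
      exact Real.sqrt_le_sqrt hc₁Φ
    have hT0 : 0 ≤ T := by
      have := Finset.sum_nonneg fun i (_ : i ∈ Finset.univ) => hX i
      linarith
    have hpos : 0 < √(c₁ ^ 2 - S) - T :=
      sub_pos.2 ((Real.lt_sqrt hT0).2 (by linarith))
    have hdiff : |C * Λ - Φ| ≤ T := by
      have heq : C * Λ - Φ = (C * η₀ - r (C * η₀)) +
          ∑ j, (x j : ℝ) * (C * η j - r (C * η j)) := by
        simp only [hΛ, hΦ, mul_sub, Finset.sum_sub_distrib, mul_add, Finset.mul_sum,
          mul_left_comm C]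
        ring
      have hterm : |∑ j, (x j : ℝ) * (C * η j - r (C * η j))| ≤ ∑ j, X j * (1 / 2) :=
        (Finset.abs_sum_le_sum_abs _ _).trans <| Finset.sum_le_sum fun j _ => by
          rw [abs_mul]
          exact mul_le_mul (hx j) (hr _) (abs_nonneg _) (hX j)
      rw [← Finset.sum_mul] at hterm
      rw [heq, hT]
      refine (abs_add_le _ _).trans ?_
      linarith [hr (C * η₀)]
    have hCΛ : |C * Λ| ≤ C * (c₃ * Real.exp (-c₄ * H)) := by
      rw [abs_mul, abs_of_pos hC]
      exact mul_le_mul_of_nonneg_left hH hC.le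
    have hkey : √(c₁ ^ 2 - S) - T ≤ C * c₃ * Real.exp (-c₄ * H) := by
      have := abs_sub_abs_le_abs_sub Φ (C * Λ)
      rw [abs_sub_comm] at this
      linarith
    have hlog := Real.log_le_log hpos hkey
    rw [Real.log_mul (mul_pos hC hc₃).ne' (Real.exp_pos _).ne', Real.log_exp] at hlog
    rw [one_div, inv_mul_eq_div, le_div_iff₀ hc₄]
    linarith
end

section
/- Assume that Δ = A² + 4B > 0 is not a perfect square, and set α = (A + √Δ)/2, β = (A − √Δ)/2, a = u₁ − u₀·β and b = u₁ − u₀·α, where u₀, u₁ are integers; assume a·b ≠ 0. If n > m ≥ 0 are integers with b·β^n − a·α^m + b·β^m = 0, then a·α^n + b·β^n = 0; in particular |a|·|α|^n = |b|·|β|^n, so that n·log|α| + log|a| = n·log|β| + log|b|. -/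
/-- Powers of conjugate quadratic numbers, times conjugate factors, remain conjugate. -/
theorem exists_rat_conj_mul_pow (x y z w : ℚ) (s : ℝ) (D : ℚ) (hs : s ^ 2 = D) (k : ℕ) :
    ∃ p q : ℚ, ((x + y * s) * (z + w * s) ^ k : ℝ) = p + q * s ∧
      ((x - y * s) * (z - w * s) ^ k : ℝ) = p - q * s := by
  induction k with
  | zero => exact ⟨x, y, by simp, by simp⟩
  | succ k ih =>
    obtain ⟨p, q, h₁, h₂⟩ := ih
    refine ⟨p * z + q * w * D, p * w + q * z, ?_, ?_⟩
    · rw [pow_succ, ← mul_assoc, h₁]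
      push_cast
      rw [← hs]
      ring
    · rw [pow_succ, ← mul_assoc, h₂]
      push_cast
      rw [← hs]
      ring

/-- A rational linear relation between `1` and an irrational number is trivial. -/
theorem Irrational.eq_zero_of_add_mul_eq_zero {s : ℝ} (hs : Irrational s) {p q : ℚ}
    (h : (p : ℝ) + q * s = 0) : p = 0 := by
  by_contra hp
  have hq : q ≠ 0 := by
    rintro rfl
    simp [hp] at h
  exact ((hs.ratCast_mul hq).ratCast_add p).ne_zero h

/-- in the non-square-discriminant case, the vanishing condition
`b·β^n − a·α^m + b·β^m = 0` implies `a·α^n + b·β^n = 0`, hence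
`|a||α|^n = |b||β|^n` and `n log|α| + log|a| = n log|β| + log|b|`. -/
theorem stmt_13 (A B u₀ u₁ : ℤ) (hA : A ≠ 0) (hB : B ≠ 0)
    (hΔ : (0:ℤ) < A ^ 2 + 4 * B)
    (hsq : ¬ ∃ d : ℤ, d ^ 2 = A ^ 2 + 4 * B)
    (hu01 : u₀ ≠ 0 ∨ u₁ ≠ 0)
    (α β a b : ℝ)
    (hα : α = ((A : ℝ) + Real.sqrt ((A : ℝ) ^ 2 + 4 * B)) / 2)
    (hβ : β = ((A : ℝ) - Real.sqrt ((A : ℝ) ^ 2 + 4 * B)) / 2)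
    (ha : a = (u₁ : ℝ) - u₀ * β) (hb : b = (u₁ : ℝ) - u₀ * α)
    (hab : a * b ≠ 0)
    (n m : ℕ) (hnm : m < n)
    (hvan : b * β ^ n - a * α ^ m + b * β ^ m = 0) :
    a * α ^ n + b * β ^ n = 0 ∧
    |a| * |α| ^ n = |b| * |β| ^ n ∧
    (n : ℝ) * Real.log |α| + Real.log |a| = (n : ℝ) * Real.log |β| + Real.log |b| := by
  set s := Real.sqrt ((A : ℝ) ^ 2 + 4 * B) with hs_def
  have hΔ' : (0 : ℝ) < (A : ℝ) ^ 2 + 4 * B := by exact_mod_cast hΔ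
  have hs2 : s ^ 2 = (A : ℝ) ^ 2 + 4 * B := Real.sq_sqrt hΔ'.le
  have hirr : Irrational s := by
    have h : Irrational (Real.sqrt ((A ^ 2 + 4 * B : ℤ) : ℝ)) := by
      rw [irrational_sqrt_intCast_iff]
      exact ⟨fun ⟨d, hd⟩ => hsq ⟨d, by rw [hd]; ring⟩, hΔ.le⟩
    rw [hs_def]
    exact_mod_cast h
  have conj_pow (k : ℕ) : ∃ p q : ℚ, a * α ^ k = p + q * s ∧ b * β ^ k = p - q * s := by
    obtain ⟨p, q, h₁, h₂⟩ := exists_rat_conj_mul_pow (u₁ - u₀ * A / 2) (u₀ / 2) (A / 2) (1 / 2) s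
      (A ^ 2 + 4 * B) (by rw [hs2]; push_cast; ring) k
    refine ⟨p, q, ?_, ?_⟩
    · rw [← h₁, ha, hα, hβ]
      push_cast
      ring
    · rw [← h₂, hb, hα, hβ]
      push_cast
      ring
  obtain ⟨p, q, hp₁, hp₂⟩ := conj_pow n
  obtain ⟨p', q', hp₁', hp₂'⟩ := conj_pow m
  have hp : p = 0 := by
    refine hirr.eq_zero_of_add_mul_eq_zero (q := -q - 2 * q') ?_
    push_cast
    linear_combination hvan - hp₂ + hp₁' - hp₂'
  have hsum : a * α ^ n + b * β ^ n = 0 := by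
    rw [hp₁, hp₂, hp]
    push_cast
    ring
  have habs : |a| * |α| ^ n = |b| * |β| ^ n := by
    rw [← abs_pow, ← abs_pow, ← abs_mul, ← abs_mul, eq_neg_of_add_eq_zero_left hsum, abs_neg]
  have hαβ : α * β ≠ 0 := by
    have : α * β = -(B : ℝ) := by
      rw [hα, hβ]
      linear_combination (-1 / 4) * hs2
    rw [this]
    exact neg_ne_zero.mpr (by exact_mod_cast hB)
  have log_mul_pow {x y : ℝ} (hx : x ≠ 0) (hy : y ≠ 0) :
      Real.log (|x| * |y| ^ n) = n * Real.log |y| + Real.log |x| := by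
    rw [Real.log_mul (by positivity) (by positivity), Real.log_pow, add_comm]
  refine ⟨hsum, habs, ?_⟩
  rw [← log_mul_pow (left_ne_zero_of_mul hab) (left_ne_zero_of_mul hαβ), habs,
    log_mul_pow (right_ne_zero_of_mul hab) (right_ne_zero_of_mul hαβ)]
end
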